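/- arXiv:2302.13956 — 12 statements merged into one kernel-verified Lean document; each statement's English description precedes it below -/
import Mathlib

section
/- Let two states be given, with beliefs identified with the probability x ∈ [0,1] of state 1, and fix a prior μ ∈ (0,1). A distortion function φ : [0,1] → [0,1] respects the Blackwell order for μ if and only if φ is occasionally coarse, i.e., there exist a, b with 0 ≤ a ≤ b ≤ 1 such that φ(x) = a for all x ∈ (0,a), φ(x) = b for all x ∈ (b,1), φ(x) = x for all x ∈ [a,b], φ(0) ≤ a, and φ(1) ≥ b. -/
open Set

/-- Two states: a distortion `φ` (on beliefs in `[0,1]`) respects the Blackwell order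
if for every compact decision problem and every consistent (interim-optimal) action
choice, the induced payoff function `W` is convex on `[0,1]`. -/
def RespectsBlackwell2 (φ : ℝ → ℝ) : Prop :=
  ∀ (A : Type) [TopologicalSpace A] [CompactSpace A] [Nonempty A]
    (u₀ u₁ : A → ℝ), Continuous u₀ → Continuous u₁ →
    ∀ a : ℝ → A,
      (∀ y ∈ Icc (0:ℝ) 1, ∀ b : A,
        (1 - y) * u₀ b + y * u₁ b ≤ (1 - y) * u₀ (a y) + y * u₁ (a y)) →
      ConvexOn ℝ (Icc (0:ℝ) 1)
        (fun x => (1 - x) * u₀ (a (φ x)) + x * u₁ (a (φ x)))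

/-- `φ` is occasionally coarse. -/
def OccasionallyCoarse (φ : ℝ → ℝ) : Prop :=
  ∃ a b : ℝ, 0 ≤ a ∧ a ≤ b ∧ b ≤ 1 ∧
    (∀ x ∈ Ioo (0:ℝ) a, φ x = a) ∧
    (∀ x ∈ Ioo b (1:ℝ), φ x = b) ∧
    (∀ x ∈ Icc a b, φ x = x) ∧
    φ 0 ≤ a ∧ b ≤ φ 1

/-- The expected payoff of an action optimal at `y` weakly exceeds, at every belief on the far side
of `y` from `c`, that of an action optimal at `c`. -/
lemma expected_payoff_le_of_between {p₀ p₁ q₀ q₁ x y c : ℝ}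
    (hc : (1 - c) * p₀ + c * p₁ ≤ (1 - c) * q₀ + c * q₁)
    (hy : (1 - y) * q₀ + y * q₁ ≤ (1 - y) * p₀ + y * p₁)
    (h : x ≤ y ∧ y < c ∨ c < y ∧ y ≤ x) :
    (1 - x) * q₀ + x * q₁ ≤ (1 - x) * p₀ + x * p₁ := by
  rcases h with ⟨hxy, hyc⟩ | ⟨hcy, hyx⟩
  · by_contra! hlt
    nlinarith [mul_nonneg (sub_nonneg.2 hxy) (sub_nonneg.2 hc),
      mul_nonneg (sub_nonneg.2 (hxy.trans hyc.le)) (sub_nonneg.2 hy),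
      mul_pos (sub_pos.2 hyc) (sub_pos.2 hlt)]
  · by_contra! hlt
    nlinarith [mul_nonneg (sub_nonneg.2 hyx) (sub_nonneg.2 hc),
      mul_nonneg (sub_nonneg.2 (hcy.le.trans hyx)) (sub_nonneg.2 hy),
      mul_pos (sub_pos.2 hcy) (sub_pos.2 hlt)]

/-- A function on `[0,1]` with an affine minorant touching it at each interior point is convex. -/
lemma convexOn_Icc_of_support {W L₀ L₁ : ℝ → ℝ}
    (heq : ∀ z ∈ Ioo (0 : ℝ) 1, W z = (1 - z) * L₀ z + z * L₁ z)
    (hle : ∀ z ∈ Ioo (0 : ℝ) 1, ∀ x ∈ Icc (0 : ℝ) 1, (1 - x) * L₀ z + x * L₁ z ≤ W x) :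
    ConvexOn ℝ (Icc (0 : ℝ) 1) W := by
  rw [convexOn_iff_pairwise_pos]
  refine ⟨convex_Icc 0 1, fun x hx y hy hxy s t hs ht hst => ?_⟩
  simp only [smul_eq_mul]
  have hz : s * x + t * y ∈ Ioo (0 : ℝ) 1 := by
    obtain rfl : t = 1 - s := by linarith
    rcases lt_or_gt_of_ne hxy with h | h <;> constructor <;>
      nlinarith [hx.1, hx.2, hy.1, hy.2, mul_pos hs (sub_pos.2 h), mul_pos ht (sub_pos.2 h)]
  have h₁ := mul_le_mul_of_nonneg_left (hle _ hz x hx) hs.le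
  have h₂ := mul_le_mul_of_nonneg_left (hle _ hz y hy) ht.le
  rw [heq _ hz]
  set p := L₀ (s * x + t * y)
  set q := L₁ (s * x + t * y)
  obtain rfl : t = 1 - s := by linarith
  linarith

lemma OccasionallyCoarse.respectsBlackwell2 {φ : ℝ → ℝ}
    (hφ : MapsTo φ (Icc (0 : ℝ) 1) (Icc (0 : ℝ) 1)) (h : OccasionallyCoarse φ) :
    RespectsBlackwell2 φ := by
  obtain ⟨a, b, ha, hab, hb, hlow, hhigh, hmid, h0, h1⟩ := h
  intro A _ _ _ u₀ u₁ _ _ act hact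
  refine convexOn_Icc_of_support (L₀ := fun z => u₀ (act (φ z)))
    (L₁ := fun z => u₁ (act (φ z))) (fun z _ => rfl) fun z hz x hx => ?_
  have hzI : z ∈ Icc (0 : ℝ) 1 := Ioo_subset_Icc_self hz
  have hza : a ≤ φ z ∧ φ z ≤ b := by
    rcases lt_or_ge z a with h | h
    · rw [hlow z ⟨hz.1, h⟩]; exact ⟨le_rfl, hab⟩
    rcases lt_or_ge b z with h' | h'
    · rw [hhigh z ⟨h', hz.2⟩]; exact ⟨hab, le_rfl⟩
    · rw [hmid z ⟨h, h'⟩]; exact ⟨h, h'⟩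
  have hxφ : φ x = x ∨ (x ≤ φ x ∧ φ x ≤ a) ∨ (b ≤ φ x ∧ φ x ≤ x) := by
    rcases lt_or_ge x a with h | h
    · rcases hx.1.eq_or_lt with rfl | hx0
      · exact .inr (.inl ⟨(hφ hx).1, h0⟩)
      · rw [hlow x ⟨hx0, h⟩]; exact .inr (.inl ⟨h.le, le_rfl⟩)
    rcases lt_or_ge b x with h' | h'
    · rcases hx.2.eq_or_lt with rfl | hx1
      · exact .inr (.inr ⟨h1, (hφ hx).2⟩)
      · rw [hhigh x ⟨h', hx1⟩]; exact .inr (.inr ⟨le_rfl, h'.le⟩)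
    · exact .inl (hmid x ⟨h, h'⟩)
  rcases hxφ with h | h
  · simpa only [h] using hact x hx (act (φ z))
  by_cases he : φ x = φ z
  · rw [he]
  refine expected_payoff_le_of_between (hact _ (hφ hzI) (act (φ x)))
    (hact _ (hφ hx) (act (φ z))) ?_
  rcases h with h | h
  · exact .inl ⟨h.1, lt_of_le_of_ne (h.2.trans hza.1) he⟩
  · exact .inr ⟨lt_of_le_of_ne (hza.2.trans h.1) (Ne.symm he), h.2⟩

/-- The payoff from a safe action yielding `0` and a risky one yielding `x - c` at belief `x`. -/
lemma RespectsBlackwell2.convexOn_threshold {φ : ℝ → ℝ} (h : RespectsBlackwell2 φ) (c : ℝ) :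
    ConvexOn ℝ (Icc (0 : ℝ) 1) (fun x => if c < φ x then x - c else 0) := by
  classical
  have := h Bool (fun r => if r then -c else 0) (fun r => if r then 1 - c else 0)
    continuous_of_discreteTopology continuous_of_discreteTopology (fun y => decide (c < y)) ?_
  · refine this.congr fun x _ => ?_
    by_cases hx : c < φ x <;> simp [hx]
    ring
  · intro y _ r
    by_cases hy : c < y <;> cases r <;> simp [hy] <;> nlinarith

/-- Relabelling the states. -/
lemma RespectsBlackwell2.reflect {φ : ℝ → ℝ} (h : RespectsBlackwell2 φ) :
    RespectsBlackwell2 (fun x => 1 - φ (1 - x)) := by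
  intro A _ _ _ u₀ u₁ hu₀ hu₁ act hact
  have key := h A u₁ u₀ hu₁ hu₀ (fun y => act (1 - y)) fun y hy b => by
    have := hact (1 - y) ⟨by linarith [hy.2], by linarith [hy.1]⟩ b
    simp only [sub_sub_cancel] at this
    linarith
  refine ⟨convex_Icc 0 1, fun x hx y hy s t hs ht hst => ?_⟩
  have := key.2 (x := 1 - x) (y := 1 - y) ⟨by linarith [hx.2], by linarith [hx.1]⟩
    ⟨by linarith [hy.2], by linarith [hy.1]⟩ hs ht hst
  have he : s * (1 - x) + t * (1 - y) = 1 - (s * x + t * y) := by linear_combination hst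
  simp only [smul_eq_mul, he, sub_sub_cancel] at this ⊢
  linarith

/-- An upward distortion at one belief is a lower bound for all distorted interior beliefs. -/
lemma RespectsBlackwell2.le_of_lt {φ : ℝ → ℝ}
    (hφ : MapsTo φ (Icc (0 : ℝ) 1) (Icc (0 : ℝ) 1)) (h : RespectsBlackwell2 φ) {x z : ℝ}
    (hx : x ∈ Icc (0 : ℝ) 1) (hlt : x < φ x) (hz : z ∈ Ioc (0 : ℝ) 1) : φ x ≤ φ z := by
  have hzI : z ∈ Icc (0 : ℝ) 1 := Ioc_subset_Icc_self hz
  have step : ∀ c, x < c → c < φ x → z ≠ c → c < φ z := by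
    intro c hxc hcφ hzc
    by_contra hcz
    have hconv := h.convexOn_threshold c
    have hcI : c ∈ Icc (0 : ℝ) 1 := ⟨hx.1.trans hxc.le, hcφ.le.trans (hφ hx).2⟩
    have hc0 : (if c < φ c then c - c else 0) = 0 := by simp
    rcases lt_trichotomy z x with hzx | rfl | hxz
    · have hs := hconv.slope_mono_adjacent (left_mem_Icc.2 zero_le_one) hx hz.1 hzx
      have hg0 : (if c < φ 0 then 0 - c else 0) ≤ 0 := by
        split_ifs <;> linarith [hcI.1]
      simp only [if_pos hcφ, if_neg hcz] at hs
      have h₁ := div_nonneg (sub_nonneg.2 hg0) (sub_nonneg.2 hz.1.le)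
      have h₂ : (x - c - 0) / (x - z) < 0 := div_neg_of_neg_of_pos (by linarith) (by linarith)
      linarith
    · exact hcz hcφ
    · rcases lt_or_gt_of_ne hzc with hzc | hcz'
      · have hs := hconv.slope_mono_adjacent hx hcI hxz hzc
        simp only [if_pos hcφ, if_neg hcz, hc0, sub_zero, zero_div] at hs
        have : 0 < (0 - (x - c)) / (z - x) := div_pos (by linarith) (by linarith)
        linarith
      · have hs := hconv.slope_mono_adjacent hx hzI hxc hcz'
        simp only [if_pos hcφ, if_neg hcz, hc0, sub_zero, zero_div] at hs
        have : 0 < (0 - (x - c)) / (c - x) := div_pos (by linarith) (by linarith)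
        linarith
  by_contra! hlt'
  obtain ⟨c, hc₁, hc₂⟩ := exists_between (max_lt hlt hlt')
  obtain ⟨d, hd₁, hd₂⟩ := exists_between hc₂
  have hxc := (le_max_left _ _).trans_lt hc₁
  have hzc := (le_max_right _ _).trans_lt hc₁
  by_cases he : z = c
  · exact absurd (step d (hxc.trans hd₁) hd₂ (by rw [he]; exact hd₁.ne)) (by linarith)
  · exact absurd (step c hxc hc₂ he) hzc.not_gt

/-- A downward distortion at one belief is an upper bound for all distorted interior beliefs. -/
lemma RespectsBlackwell2.le_of_gt {φ : ℝ → ℝ}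
    (hφ : MapsTo φ (Icc (0 : ℝ) 1) (Icc (0 : ℝ) 1)) (h : RespectsBlackwell2 φ) {x z : ℝ}
    (hx : x ∈ Icc (0 : ℝ) 1) (hlt : φ x < x) (hz : z ∈ Ico (0 : ℝ) 1) : φ z ≤ φ x := by
  have hφ' : MapsTo (fun x => 1 - φ (1 - x)) (Icc (0 : ℝ) 1) (Icc (0 : ℝ) 1) := fun y hy => by
    have := hφ (x := 1 - y) ⟨by linarith [hy.2], by linarith [hy.1]⟩
    exact ⟨by linarith [this.2], by linarith [this.1]⟩
  have := h.reflect.le_of_lt hφ' (x := 1 - x) (z := 1 - z)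
    ⟨by linarith [hx.2], by linarith [hx.1]⟩ (by simpa using hlt)
    ⟨by linarith [hz.2], by linarith [hz.1]⟩
  simp only [sub_sub_cancel] at this
  linarith

/-- The left end of the undistorted interval. -/
lemma RespectsBlackwell2.exists_left {φ : ℝ → ℝ}
    (hφ : MapsTo φ (Icc (0 : ℝ) 1) (Icc (0 : ℝ) 1)) (h : RespectsBlackwell2 φ) :
    ∃ a, 0 ≤ a ∧ a ≤ 1 ∧ (∀ x ∈ Ioo (0 : ℝ) a, φ x = a) ∧
      (∀ x ∈ Icc (0 : ℝ) 1, a ≤ x → φ x ≤ x) ∧ φ 0 ≤ a ∧ ∀ x ∈ Ioc (0 : ℝ) 1, a ≤ φ x := by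
  have h0 : (0 : ℝ) ∈ Icc (0 : ℝ) 1 := left_mem_Icc.2 zero_le_one
  by_cases hex : ∃ x ∈ Ioo (0 : ℝ) 1, x < φ x
  · obtain ⟨x, hx, hlt⟩ := hex
    have hxI : x ∈ Icc (0 : ℝ) 1 := Ioo_subset_Icc_self hx
    have hxI' : x ∈ Ioc (0 : ℝ) 1 := Ioo_subset_Ioc_self hx
    have hle1 := (hφ hxI).2
    refine ⟨φ x, (hφ hxI).1, hle1, fun y hy => ?_, fun y hy hxy => ?_, ?_,
      fun y hy => h.le_of_lt hφ hxI hlt hy⟩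
    · have hy1 : y ≤ 1 := hy.2.le.trans hle1
      have hge := h.le_of_lt hφ hxI hlt ⟨hy.1, hy1⟩
      exact le_antisymm (h.le_of_lt hφ ⟨hy.1.le, hy1⟩ (hy.2.trans_le hge) hxI') hge
    · by_contra! hyφ
      linarith [h.le_of_lt hφ hy hyφ hxI']
    · rcases (hφ h0).1.eq_or_lt with he | hpos
      · exact he ▸ (hφ hxI).1
      · exact h.le_of_lt hφ h0 hpos hxI'
  · push Not at hex
    have hφ0 : φ 0 ≤ 0 := by
      by_contra! hpos
      have hle1 := (hφ h0).2
      have h₁ := h.le_of_lt hφ h0 hpos (z := φ 0 / 2) ⟨by linarith, by linarith⟩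
      have h₂ := hex (φ 0 / 2) ⟨by linarith, by linarith⟩
      linarith
    refine ⟨0, le_rfl, zero_le_one, fun x hx => absurd hx.2 hx.1.not_gt, fun x hx _ => ?_, hφ0,
      fun x hx => (hφ (Ioc_subset_Icc_self hx)).1⟩
    rcases hx.1.eq_or_lt with rfl | hx0
    · exact hφ0
    rcases hx.2.eq_or_lt with rfl | hx1
    · exact (hφ hx).2
    · exact hex x ⟨hx0, hx1⟩

lemma RespectsBlackwell2.occasionallyCoarse {φ : ℝ → ℝ}
    (hφ : MapsTo φ (Icc (0 : ℝ) 1) (Icc (0 : ℝ) 1)) (h : RespectsBlackwell2 φ) :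
    OccasionallyCoarse φ := by
  have hφ' : MapsTo (fun x => 1 - φ (1 - x)) (Icc (0 : ℝ) 1) (Icc (0 : ℝ) 1) := fun y hy => by
    have := hφ (x := 1 - y) ⟨by linarith [hy.2], by linarith [hy.1]⟩
    exact ⟨by linarith [this.2], by linarith [this.1]⟩
  obtain ⟨a, ha0, ha1, halow, hale, haφ, hage⟩ := h.exists_left hφ
  obtain ⟨b, hb0, hb1, hblow, hble, hbφ, hbge⟩ := h.reflect.exists_left hφ'
  have hhalf := hage (1 / 2) ⟨by norm_num, by norm_num⟩
  have hhalf' := hbge (1 / 2) ⟨by norm_num, by norm_num⟩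
  norm_num at hhalf hhalf'
  refine ⟨a, 1 - b, ha0, by linarith, by linarith, halow, fun x hx => ?_, fun x hx => ?_, haφ, ?_⟩
  · have := hblow (1 - x) ⟨by linarith [hx.2], by linarith [hx.1]⟩
    simp only [sub_sub_cancel] at this
    linarith
  · have hxI : x ∈ Icc (0 : ℝ) 1 := ⟨ha0.trans hx.1, by linarith [hx.2]⟩
    have := hble (1 - x) ⟨by linarith [hxI.2], by linarith [hxI.1]⟩ (by linarith [hx.2])
    simp only [sub_sub_cancel] at this
    exact le_antisymm (hale x hxI hx.1) (by linarith)
  · simp only [sub_zero] at hbφ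
    linarith

theorem blackwell_iff_occasionallyCoarse
    (μ : ℝ) (hμ : μ ∈ Ioo (0:ℝ) 1)
    (φ : ℝ → ℝ) (hφ : MapsTo φ (Icc (0:ℝ) 1) (Icc (0:ℝ) 1)) :
    RespectsBlackwell2 φ ↔ OccasionallyCoarse φ :=
  ⟨fun h => h.occasionallyCoarse hφ, fun h => h.respectsBlackwell2 hφ⟩
end

section
/- Let n ≥ 3, let Δ be the standard simplex of probability vectors on Fin n, and fix a prior μ in the relative interior of Δ. If a distortion function φ : Δ → Δ respects the Blackwell order for μ, then either φ(x) = x for all x ∈ Δ (Bayes' law), or there exists x* ∈ Δ such that φ(x) = x* for all x in the relative interior of Δ (φ is trivial on the relative interior). -/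
open Set Finset

/-- The relative interior of the standard simplex: full-support probability vectors. -/
def relintSimplex (n : ℕ) : Set (Fin n → ℝ) :=
  {x ∈ stdSimplex ℝ (Fin n) | ∀ θ, 0 < x θ}

/-- A distortion `φ` on beliefs in the standard simplex respects the Blackwell order
if for every compact decision problem `(A, u)` and every consistent (interim-optimal)
action choice `a`, the induced payoff function `W` is convex on the simplex. -/
def RespectsBlackwell (n : ℕ) (φ : (Fin n → ℝ) → (Fin n → ℝ)) : Prop :=
  ∀ (A : Type) [TopologicalSpace A] [CompactSpace A] [Nonempty A]
    (u : A → Fin n → ℝ), Continuous u →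
    ∀ a : (Fin n → ℝ) → A,
      (∀ y ∈ stdSimplex ℝ (Fin n), ∀ b : A,
        ∑ θ, y θ * u b θ ≤ ∑ θ, y θ * u (a y) θ) →
      ConvexOn ℝ (stdSimplex ℝ (Fin n)) (fun x => ∑ θ, x θ * u (a (φ x)) θ)

open Matrix

/-- The payoff of the two-action problem with utilities `v` and `0`, ties broken towards `0`. -/
noncomputable def binaryPayoff {n : ℕ} (φ : (Fin n → ℝ) → Fin n → ℝ) (v x : Fin n → ℝ) : ℝ :=
  open Classical in if 0 < φ x ⬝ᵥ v then x ⬝ᵥ v else 0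

theorem RespectsBlackwell.convexOn_binaryPayoff {n : ℕ} {φ : (Fin n → ℝ) → Fin n → ℝ}
    (hB : RespectsBlackwell n φ) (v : Fin n → ℝ) :
    ConvexOn ℝ (stdSimplex ℝ (Fin n)) (binaryPayoff φ v) := by
  classical
  have h := hB Bool (fun b => if b then v else 0) continuous_of_discreteTopology
    (fun y => decide (0 < y ⬝ᵥ v)) ?_
  · convert h using 2 with x
    change _ = x ⬝ᵥ _
    by_cases hx : 0 < φ x ⬝ᵥ v <;> simp [binaryPayoff, hx]
  · intro y _ b
    change y ⬝ᵥ _ ≤ y ⬝ᵥ _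
    by_cases hy : 0 < y ⬝ᵥ v <;> cases b <;> simp [hy] <;> linarith

theorem dotProduct_one_of_mem_stdSimplex {n : ℕ} {x : Fin n → ℝ}
    (hx : x ∈ stdSimplex ℝ (Fin n)) : x ⬝ᵥ (1 : Fin n → ℝ) = 1 := by
  simpa [dotProduct] using hx.2

theorem exists_extension_mem_stdSimplex {n : ℕ} {x z : Fin n → ℝ}
    (hx : x ∈ stdSimplex ℝ (Fin n)) (hz : z ∈ relintSimplex n) :
    ∃ δ : ℝ, 0 < δ ∧ ∀ ε ∈ Set.Icc 0 δ, z + ε • (z - x) ∈ stdSimplex ℝ (Fin n) := by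
  obtain ⟨δ, hδ, h⟩ : ∃ δ : ℝ, 0 < δ ∧ ∀ θ, δ ≤ z θ := by
    rcases isEmpty_or_nonempty (Fin n) with _ | _
    · exact ⟨1, one_pos, fun θ => isEmptyElim θ⟩
    · obtain ⟨θ₀, h₀⟩ := Finite.exists_min z
      exact ⟨z θ₀, hz.2 θ₀, h₀⟩
  refine ⟨δ, hδ, fun ε hε => ⟨fun θ => ?_, ?_⟩⟩
  · have h1 : x θ ≤ 1 := hx.2 ▸ single_le_sum (fun i _ => hx.1 i) (mem_univ θ)
    have h2 := hz.2 θ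
    have h3 := h θ
    have h4 := hx.1 θ
    simp only [Pi.add_apply, Pi.smul_apply, Pi.sub_apply, smul_eq_mul]
    nlinarith [hε.1, hε.2]
  · simp [sum_add_distrib, ← mul_sum, hx.2, hz.1.2]

section BinaryChoice

variable {n : ℕ} {W : (Fin n → ℝ) → ℝ} {v : Fin n → ℝ}

/-- If a convex `W` with values in `{0, x ⬝ᵥ v}` picks the negative branch somewhere, it picks it
on the whole negative side. -/
theorem eq_dotProduct_of_neg (hW : ConvexOn ℝ (stdSimplex ℝ (Fin n)) W)
    (hv : ∀ x, W x = 0 ∨ W x = x ⬝ᵥ v) {x z : Fin n → ℝ} (hx : x ∈ stdSimplex ℝ (Fin n))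
    (hz : z ∈ relintSimplex n) (hWx : W x < 0) (hzv : z ⬝ᵥ v < 0) : W z = z ⬝ᵥ v := by
  refine (hv z).resolve_left fun h0 => ?_
  obtain ⟨δ, hδ, hext⟩ := exists_extension_mem_stdSimplex hx hz
  have hxv : x ⬝ᵥ v < 0 := by rcases hv x with h | h <;> linarith
  obtain ⟨ε, hε, hεδ, hε'⟩ : ∃ ε > 0, ε ≤ δ ∧ z ⬝ᵥ v + ε * (z ⬝ᵥ v - x ⬝ᵥ v) < 0 := by
    refine ⟨min δ (-(z ⬝ᵥ v) / (-(x ⬝ᵥ v))), lt_min hδ (div_pos (by linarith) (by linarith)),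
      min_le_left _ _, ?_⟩
    set ε := min δ (-(z ⬝ᵥ v) / (-(x ⬝ᵥ v)))
    have h1 : ε ≤ -(z ⬝ᵥ v) / (-(x ⬝ᵥ v)) := min_le_right _ _
    have h2 : 0 < ε := lt_min hδ (div_pos (by linarith) (by linarith))
    rw [le_div_iff₀ (by linarith)] at h1
    nlinarith
  have hle : W (z + ε • (z - x)) ≤ 0 := by
    rcases hv (z + ε • (z - x)) with h | h
    · exact h.le
    · rw [h, add_dotProduct, smul_dotProduct, sub_dotProduct]
      exact hε'.le
  have h1ε : 0 < 1 + ε := by linarith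
  have hconv := hW.2 hx (hext ε ⟨hε.le, hεδ⟩) (div_pos hε h1ε).le (one_div_pos.2 h1ε).le
    (by field_simp; ring)
  have hz' : (ε / (1 + ε)) • x + (1 / (1 + ε)) • (z + ε • (z - x)) = z := by
    ext θ
    simp only [Pi.add_apply, Pi.smul_apply, Pi.sub_apply, smul_eq_mul]
    field_simp
    ring
  rw [hz', h0, smul_eq_mul, smul_eq_mul] at hconv
  have := mul_neg_of_pos_of_neg (div_pos hε h1ε) hWx
  have := mul_nonpos_of_nonneg_of_nonpos (one_div_pos.2 h1ε).le hle
  linarith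

theorem relintSimplex_segment {x y : Fin n → ℝ} (hx : x ∈ relintSimplex n)
    (hy : y ∈ stdSimplex ℝ (Fin n)) {a b : ℝ} (ha : 0 < a) (hb : 0 ≤ b) (hab : a + b = 1) :
    a • x + b • y ∈ relintSimplex n := by
  refine ⟨convex_stdSimplex ℝ (Fin n) hx.1 hy ha.le hb hab, fun θ => ?_⟩
  have := mul_pos ha (hx.2 θ)
  have := mul_nonneg hb (hy.1 θ)
  simp only [Pi.add_apply, Pi.smul_apply, smul_eq_mul]
  linarith

theorem dotProduct_eq_zero_of_neg (hW : ConvexOn ℝ (stdSimplex ℝ (Fin n)) W)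
    (hv : ∀ x, W x = 0 ∨ W x = x ⬝ᵥ v) {x z : Fin n → ℝ} (hx : x ∈ relintSimplex n)
    (hz : z ∈ relintSimplex n) (hWx : W x < 0) (hWz : W z = 0) : z ⬝ᵥ v = 0 := by
  have hWx' : W x = x ⬝ᵥ v := (hv x).resolve_left hWx.ne
  rcases lt_trichotomy (z ⬝ᵥ v) 0 with h | h | h
  · rw [← hWz, eq_dotProduct_of_neg hW hv hx.1 hz hWx h]
  · exact h
  · exfalso
    obtain ⟨b, hb, hb1, hlt⟩ : ∃ b > 0, b < 1 ∧ (1 - b) * (x ⬝ᵥ v) + b * (z ⬝ᵥ v) < 0 := by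
      have hd : 0 < 2 * (z ⬝ᵥ v - x ⬝ᵥ v) := by linarith
      refine ⟨-(x ⬝ᵥ v) / (2 * (z ⬝ᵥ v - x ⬝ᵥ v)), div_pos (by linarith) hd, ?_, ?_⟩
      · rw [div_lt_one hd]; linarith
      · have : -(x ⬝ᵥ v) / (2 * (z ⬝ᵥ v - x ⬝ᵥ v)) * (2 * (z ⬝ᵥ v - x ⬝ᵥ v)) = -(x ⬝ᵥ v) :=
          div_mul_cancel₀ _ hd.ne'
        nlinarith
    have hm := relintSimplex_segment hx hz.1 (sub_pos.2 hb1) hb.le (sub_add_cancel 1 b)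
    have hmv : ((1 - b) • x + b • z) ⬝ᵥ v = (1 - b) * (x ⬝ᵥ v) + b * (z ⬝ᵥ v) := by
      simp [add_dotProduct]
    have hconv := hW.2 hx.1 hz.1 (sub_pos.2 hb1).le hb.le (sub_add_cancel 1 b)
    rw [eq_dotProduct_of_neg hW hv hx.1 hm hWx (hmv ▸ hlt), hmv, hWx', hWz] at hconv
    simp only [smul_eq_mul, mul_zero, add_zero] at hconv
    nlinarith

end BinaryChoice

section Distortion

variable {n : ℕ} {φ : (Fin n → ℝ) → Fin n → ℝ}

/-- A hyperplane that strictly separates two posteriors weakly separates the beliefs. -/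
theorem RespectsBlackwell.dotProduct_nonneg
    (hφ : MapsTo φ (stdSimplex ℝ (Fin n)) (stdSimplex ℝ (Fin n))) (hB : RespectsBlackwell n φ)
    {x y v : Fin n → ℝ} (hx : x ∈ relintSimplex n) (hy : y ∈ relintSimplex n)
    (hxv : 0 < φ x ⬝ᵥ v) (hyv : φ y ⬝ᵥ v < 0) : 0 ≤ x ⬝ᵥ v := by
  have key : ∀ w : Fin n → ℝ, 0 < φ x ⬝ᵥ w → φ y ⬝ᵥ w < 0 → x ⬝ᵥ w < 0 → y ⬝ᵥ w = 0 := by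
    intro w h1 h2 h3
    refine dotProduct_eq_zero_of_neg (hB.convexOn_binaryPayoff w) (fun z => ?_) hx hy ?_ ?_
    · unfold binaryPayoff
      split_ifs <;> simp
    · simpa [binaryPayoff, h1] using h3
    · simp [binaryPayoff, h2.le]
  by_contra! h
  have hy0 := key v hxv hyv h
  obtain ⟨ε, hε, hεm⟩ := exists_between (lt_min (neg_pos.2 hyv) (neg_pos.2 h))
  have hε1 := hεm.trans_le (min_le_left _ _)
  have hε2 := hεm.trans_le (min_le_right _ _)
  have hshift : ∀ z ∈ stdSimplex ℝ (Fin n), z ⬝ᵥ (v + ε • 1) = z ⬝ᵥ v + ε := by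
    intro z hz
    rw [dotProduct_add, dotProduct_smul, dotProduct_one_of_mem_stdSimplex hz, smul_eq_mul, mul_one]
  have := key (v + ε • 1) (by rw [hshift _ (hφ hx.1)]; linarith)
    (by rw [hshift _ (hφ hy.1)]; linarith) (by rw [hshift _ hx.1]; linarith)
  rw [hshift _ hy.1] at this
  linarith

theorem exists_separating_of_ne {p q : Fin n → ℝ} (hp : p ∈ stdSimplex ℝ (Fin n))
    (hq : q ∈ stdSimplex ℝ (Fin n)) (hpq : p ≠ q) :
    ∃ w : Fin n → ℝ, 0 < p ⬝ᵥ w ∧ q ⬝ᵥ w < 0 := by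
  have hpos : 0 < (p - q) ⬝ᵥ (p - q) := by
    refine lt_of_le_of_ne (sum_nonneg fun i _ => mul_self_nonneg _) fun h => hpq ?_
    exact sub_eq_zero.1 (dotProduct_self_eq_zero.1 h.symm)
  rw [sub_dotProduct] at hpos
  refine ⟨(p - q) - ((p ⬝ᵥ (p - q) + q ⬝ᵥ (p - q)) / 2) • 1, ?_, ?_⟩ <;>
    rw [dotProduct_sub, dotProduct_smul, smul_eq_mul]
  · rw [dotProduct_one_of_mem_stdSimplex hp]; linarith
  · rw [dotProduct_one_of_mem_stdSimplex hq]; linarith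

theorem mem_span_of_dotProduct_eq_zero {s : Set (Fin n → ℝ)} {x : Fin n → ℝ}
    (h : ∀ v : Fin n → ℝ, (∀ y ∈ s, y ⬝ᵥ v = 0) → x ⬝ᵥ v = 0) : x ∈ Submodule.span ℝ s := by
  by_contra hx
  obtain ⟨f, hfx, hf⟩ := Submodule.exists_le_ker_of_notMem hx
  have hrep : ∀ y, y ⬝ᵥ (fun i => f (Pi.single i 1)) = f y := by
    intro y
    conv_rhs => rw [pi_eq_sum_univ' y]
    simp [dotProduct, map_sum]
  refine hfx ?_
  rw [← hrep]
  refine h _ fun y hy => ?_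
  rw [hrep]
  exact hf (Submodule.subset_span hy)

theorem RespectsBlackwell.exists_eq_lineMap_image
    (hφ : MapsTo φ (stdSimplex ℝ (Fin n)) (stdSimplex ℝ (Fin n))) (hB : RespectsBlackwell n φ)
    {x y : Fin n → ℝ} (hx : x ∈ relintSimplex n) (hy : y ∈ relintSimplex n) (hxy : φ x ≠ φ y) :
    ∃ t : ℝ, x = φ x + t • (φ y - φ x) := by
  obtain ⟨w, hw1, hw2⟩ := exists_separating_of_ne (hφ hx.1) (hφ hy.1) hxy
  have hmem : x ∈ Submodule.span ℝ {φ x, φ y} := by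
    refine mem_span_of_dotProduct_eq_zero fun v hv => ?_
    have h1 : φ x ⬝ᵥ v = 0 := hv _ (by simp)
    have h2 : φ y ⬝ᵥ v = 0 := hv _ (by simp)
    have hline : ∀ t : ℝ, 0 ≤ x ⬝ᵥ w + t * (x ⬝ᵥ v) := by
      intro t
      have := hB.dotProduct_nonneg hφ hx hy (v := w + t • v)
        (by simpa [dotProduct_add, h1] using hw1) (by simpa [dotProduct_add, h2] using hw2)
      simpa [dotProduct_add] using this
    by_contra hne
    have := hline (-(x ⬝ᵥ w + 1) / (x ⬝ᵥ v))
    rw [div_mul_cancel₀ _ hne] at this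
    linarith
  obtain ⟨a, b, hab⟩ := Submodule.mem_span_pair.1 hmem
  have hsum : a + b = 1 := by
    have := congrArg (· ⬝ᵥ (1 : Fin n → ℝ)) hab
    simpa only [add_dotProduct, smul_dotProduct, dotProduct_one_of_mem_stdSimplex (hφ hx.1),
      dotProduct_one_of_mem_stdSimplex (hφ hy.1), dotProduct_one_of_mem_stdSimplex hx.1,
      smul_eq_mul, mul_one] using this
  refine ⟨b, ?_⟩
  conv_lhs => rw [← hab, eq_sub_of_add_eq hsum]
  module

theorem RespectsBlackwell.exists_image_eq_lineMap
    (hφ : MapsTo φ (stdSimplex ℝ (Fin n)) (stdSimplex ℝ (Fin n))) (hB : RespectsBlackwell n φ)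
    {x y : Fin n → ℝ} (hx : x ∈ relintSimplex n) (hy : y ∈ relintSimplex n) (hxy : φ x ≠ φ y) :
    ∃ s : ℝ, φ x = x + s • (y - x) := by
  obtain ⟨t, ht⟩ := hB.exists_eq_lineMap_image hφ hx hy hxy
  obtain ⟨r, hr⟩ := hB.exists_eq_lineMap_image hφ hy hx hxy.symm
  have hd : y - x = (1 - r - t) • (φ y - φ x) := by
    linear_combination (norm := module) hr - ht
  have hne : 1 - r - t ≠ 0 := by
    intro h0
    rw [h0, zero_smul, sub_eq_zero] at hd
    exact hxy (by rw [hd])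
  refine ⟨-t / (1 - r - t), ?_⟩
  rw [hd, smul_smul, div_mul_cancel₀ _ hne]
  linear_combination (norm := module) -ht

theorem exists_mem_relintSimplex_notMem_span (hn : 3 ≤ n) {x : Fin n → ℝ}
    (hx : x ∈ relintSimplex n) (y : Fin n → ℝ) :
    ∃ z ∈ relintSimplex n, z ∉ Submodule.span ℝ {x, y} := by
  obtain ⟨θ, hθ⟩ : ∃ θ : Fin n, Pi.single θ (1 : ℝ) ∉ Submodule.span ℝ {x, y} := by
    by_contra! h
    have htop : Submodule.span ℝ {x, y} = ⊤ := by
      rw [eq_top_iff, ← (Pi.basisFun ℝ (Fin n)).span_eq, Submodule.span_le]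
      rintro _ ⟨θ, rfl⟩
      simpa using h θ
    have hfin : Module.finrank ℝ (Submodule.span ℝ {x, y}) = n := by
      rw [htop, finrank_top, Module.finrank_fin_fun]
    classical
    have hle := finrank_span_finset_le_card (R := ℝ) ({x, y} : Finset (Fin n → ℝ))
    rw [Finset.coe_insert, Finset.coe_singleton, Set.finrank, hfin] at hle
    have := hle.trans Finset.card_le_two
    omega
  refine ⟨(1 / 2 : ℝ) • x + (1 / 2 : ℝ) • Pi.single θ 1,
    relintSimplex_segment hx (single_mem_stdSimplex ℝ θ) (by norm_num) (by norm_num)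
      (by norm_num), fun h => hθ ?_⟩
  have hxs : x ∈ Submodule.span ℝ {x, y} := Submodule.subset_span (by simp)
  have := (Submodule.add_mem_iff_right _ (Submodule.smul_mem _ _ hxs)).1 h
  exact (Submodule.smul_mem_iff _ (by norm_num)).1 this

/-- Beliefs with different posteriors are fixed by the distortion. -/
theorem RespectsBlackwell.apply_eq_self_of_ne (hn : 3 ≤ n)
    (hφ : MapsTo φ (stdSimplex ℝ (Fin n)) (stdSimplex ℝ (Fin n))) (hB : RespectsBlackwell n φ)
    {x y : Fin n → ℝ} (hx : x ∈ relintSimplex n) (hy : y ∈ relintSimplex n) (hxy : φ x ≠ φ y) :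
    φ x = x := by
  obtain ⟨z, hz, hzs⟩ := exists_mem_relintSimplex_notMem_span hn hx y
  have hcoef : ∀ a b c : ℝ, a • x + b • y = c • z → c = 0 := by
    intro a b c h
    by_contra hc
    refine hzs ((Submodule.smul_mem_iff _ hc).1 (h ▸ ?_))
    exact Submodule.mem_span_pair.2 ⟨a, b, rfl⟩
  obtain ⟨s, hs⟩ := hB.exists_image_eq_lineMap hφ hx hy hxy
  by_cases hxz : φ x = φ z
  · exfalso
    have hyz : φ y ≠ φ z := fun h => hxy (hxz.trans h.symm)
    obtain ⟨r, hr⟩ := hB.exists_image_eq_lineMap hφ hy hx hxy.symm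
    obtain ⟨q, hq⟩ := hB.exists_image_eq_lineMap hφ hy hz hyz
    obtain ⟨p, hp⟩ := hB.exists_image_eq_lineMap hφ hz hy hyz.symm
    have hq0 : q = 0 := by
      refine hcoef r (q - r) q ?_
      linear_combination (norm := module) hq - hr
    have hp1 : 1 - p = 0 := by
      refine hcoef (1 - s) (s - p) (1 - p) ?_
      linear_combination (norm := module) hp - hs + hxz
    obtain rfl : p = 1 := by linarith
    refine hxy ?_
    rw [hq, hxz, hp, hq0]
    module
  · obtain ⟨t, ht⟩ := hB.exists_image_eq_lineMap hφ hx hz hxz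
    have ht0 : t = 0 := by
      refine hcoef (t - s) s t ?_
      linear_combination (norm := module) ht - hs
    rw [ht, ht0, zero_smul, add_zero]

theorem RespectsBlackwell.apply_eq_self_of_relint
    (hφ : MapsTo φ (stdSimplex ℝ (Fin n)) (stdSimplex ℝ (Fin n))) (hB : RespectsBlackwell n φ)
    {p : Fin n → ℝ} (hp : p ∈ relintSimplex n) (hid : ∀ z ∈ relintSimplex n, φ z = z)
    {x : Fin n → ℝ} (hx : x ∈ stdSimplex ℝ (Fin n)) : φ x = x := by
  by_contra hne
  obtain ⟨w, hw1, hw2⟩ := exists_separating_of_ne hx (hφ hx) (Ne.symm hne)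
  have hrelint : ∀ z ∈ relintSimplex n, binaryPayoff φ w z = max (z ⬝ᵥ w) 0 := by
    intro z hz
    unfold binaryPayoff
    rw [hid z hz]
    split_ifs with h
    · exact (max_eq_left h.le).symm
    · exact (max_eq_right (not_lt.1 h)).symm
  have hWx : binaryPayoff φ w x = 0 := by simp [binaryPayoff, hw2.le]
  have hineq : ∀ t ∈ Set.Ioo (0 : ℝ) 1,
      t * (p ⬝ᵥ w) + (1 - t) * (x ⬝ᵥ w) ≤ t * max (p ⬝ᵥ w) 0 := by
    intro t ht
    have h1t : 0 ≤ 1 - t := by linarith [ht.2]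
    have hconv := (hB.convexOn_binaryPayoff w).2 hp.1 hx ht.1.le h1t (by ring)
    rw [hrelint _ (relintSimplex_segment hp hx ht.1 h1t (by ring)), hrelint p hp, hWx] at hconv
    have := (le_max_left _ _).trans hconv
    simpa [add_dotProduct] using this
  set M := max (p ⬝ᵥ w) 0 - p ⬝ᵥ w
  have hM : 0 ≤ M := sub_nonneg.2 (le_max_left _ _)
  have hD : 0 < 2 * (M + x ⬝ᵥ w) := by linarith
  have h := hineq (x ⬝ᵥ w / (2 * (M + x ⬝ᵥ w)))
    ⟨div_pos hw1 hD, by rw [div_lt_one hD]; linarith⟩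
  have hc : x ⬝ᵥ w / (2 * (M + x ⬝ᵥ w)) * (2 * (M + x ⬝ᵥ w)) = x ⬝ᵥ w :=
    div_mul_cancel₀ _ hD.ne'
  have hMdef : M = max (p ⬝ᵥ w) 0 - p ⬝ᵥ w := rfl
  nlinarith

end Distortion

theorem blackwell_implies_bayes_or_trivial
    (n : ℕ) (hn : 3 ≤ n)
    (μ : Fin n → ℝ) (hμ : μ ∈ relintSimplex n)
    (φ : (Fin n → ℝ) → (Fin n → ℝ))
    (hφ : MapsTo φ (stdSimplex ℝ (Fin n)) (stdSimplex ℝ (Fin n)))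
    (hB : RespectsBlackwell n φ) :
    (∀ x ∈ stdSimplex ℝ (Fin n), φ x = x) ∨
    (∃ xs ∈ stdSimplex ℝ (Fin n), ∀ x ∈ relintSimplex n, φ x = xs) := by
  by_cases hconst : ∀ x ∈ relintSimplex n, φ x = φ μ
  · exact Or.inr ⟨φ μ, hφ hμ.1, hconst⟩
  · push Not at hconst
    obtain ⟨y, hy, hne⟩ := hconst
    refine Or.inl fun x hx => hB.apply_eq_self_of_relint hφ hμ (fun z hz => ?_) hx
    by_cases hzμ : φ z = φ μ
    · exact hB.apply_eq_self_of_ne hn hφ hz hy (hzμ ▸ hne.symm)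
    · exact hB.apply_eq_self_of_ne hn hφ hz hμ hzμ
end

section
/- Let n ≥ 3, let Δ be the standard simplex of probability vectors on Fin n, and fix a prior μ in the relative interior of Δ. Let φ : Δ → Δ be continuous and not constant on Δ. Then φ respects the Blackwell order for μ if and only if φ(x) = x for all x ∈ Δ (Bayes' law). -/
open Set Finset

/-- Faced with the binary choice between a linear payoff `f` and a safe payoff of zero, the agent's
welfare is convex. -/
lemma RespectsBlackwell.convexOn_ite {n : ℕ} {φ : (Fin n → ℝ) → (Fin n → ℝ)}
    (h : RespectsBlackwell n φ) (f : (Fin n → ℝ) →ₗ[ℝ] ℝ) :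
    ConvexOn ℝ (stdSimplex ℝ (Fin n)) (fun x => if 0 < f (φ x) then f x else 0) := by
  classical
  have hf (x : Fin n → ℝ) : ∑ θ, x θ * f (Pi.single θ 1) = f x := by
    conv_rhs => rw [LinearMap.pi_apply_eq_sum_univ f x]
    refine Finset.sum_congr rfl fun θ _ => ?_
    rw [smul_eq_mul]
    congr 2
    ext j
    simp [Pi.single_apply, eq_comm]
  have hW := h Bool (fun b θ => if b then f (Pi.single θ 1) else 0)
    continuous_of_discreteTopology (fun y => decide (0 < f y)) (by
      intro y _ b
      rcases lt_or_ge 0 (f y) with hy | hy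
      · cases b <;> simp [hy, hf, hy.le]
      · cases b <;> simp [hy.not_gt, hf, hy])
  refine hW.congr fun x _ => ?_
  by_cases hx : 0 < f (φ x) <;> simp [hx, hf]

/-- A linear functional vanishing at `x` that is negative somewhere on the image of `φ` cannot be
positive at `φ x`. -/
lemma RespectsBlackwell.apply_nonpos {n : ℕ} {φ : (Fin n → ℝ) → (Fin n → ℝ)}
    (h : RespectsBlackwell n φ) (hφ : MapsTo φ (stdSimplex ℝ (Fin n)) (stdSimplex ℝ (Fin n)))
    (hcont : ContinuousOn φ (stdSimplex ℝ (Fin n))) (f : (Fin n → ℝ) →ₗ[ℝ] ℝ)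
    {x b : Fin n → ℝ} (hx : x ∈ stdSimplex ℝ (Fin n)) (hb : b ∈ stdSimplex ℝ (Fin n))
    (hfx : f x = 0) (hfb : f (φ b) < 0) : f (φ x) ≤ 0 := by
  by_contra! hpos
  have hfcont : ContinuousOn (fun y => f (φ y)) (stdSimplex ℝ (Fin n)) :=
    f.continuous_of_finiteDimensional.comp_continuousOn hcont
  have hmin : IsMinOn (fun x => if 0 < f (φ x) then f x else 0) (stdSimplex ℝ (Fin n)) b := by
    refine IsMinOn.of_isLocalMinOn_of_convexOn hb ?_ (h.convexOn_ite f)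
    filter_upwards [(hfcont b hb).eventually_lt_const hfb] with y hy
    simp [hfb.not_gt, hy.not_gt]
  have hpath : Filter.Tendsto (fun t : ℝ => (1 - t) • x + t • φ b) (nhdsWithin 0 (Ioi 0))
      (nhdsWithin x (stdSimplex ℝ (Fin n))) := by
    refine tendsto_nhdsWithin_iff.mpr ⟨?_, ?_⟩
    · have : Continuous (fun t : ℝ => (1 - t) • x + t • φ b) := by fun_prop
      simpa using (this.tendsto 0).mono_left nhdsWithin_le_nhds
    · filter_upwards [Ioo_mem_nhdsGT (zero_lt_one (α := ℝ))] with t ht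
      exact convex_stdSimplex ℝ (Fin n) hx (hφ hb) (by linarith [ht.2]) ht.1.le (by ring)
  obtain ⟨t, hty, htΔ, ht⟩ := ((hpath.eventually ((hfcont x hx).eventually_const_lt hpos)).and
    ((hpath.eventually self_mem_nhdsWithin).and self_mem_nhdsWithin)).exists
  have := hmin htΔ
  simp only [mem_ofPred_eq, hfb.not_gt, if_false, hty, if_true, map_add, map_smul, hfx,
    smul_eq_mul, mul_zero, zero_add] at this
  nlinarith [mul_neg_of_pos_of_neg ht hfb]

/-- If `φ` moves `x`, then its whole image lies in the plane spanned by `x` and `φ x`. -/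
lemma RespectsBlackwell.mem_span_pair {n : ℕ} {φ : (Fin n → ℝ) → (Fin n → ℝ)}
    (h : RespectsBlackwell n φ) (hφ : MapsTo φ (stdSimplex ℝ (Fin n)) (stdSimplex ℝ (Fin n)))
    (hcont : ContinuousOn φ (stdSimplex ℝ (Fin n)))
    {x b : Fin n → ℝ} (hx : x ∈ stdSimplex ℝ (Fin n)) (hb : b ∈ stdSimplex ℝ (Fin n))
    (hne : φ x ≠ x) : φ b ∈ Submodule.span ℝ {x, φ x} := by
  by_contra hspan
  have hspan' : φ x ∉ Submodule.span ℝ {x} := by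
    rw [Submodule.mem_span_singleton]
    rintro ⟨c, hc⟩
    have hsum : ∑ θ, c * x θ = 1 := by
      rw [← (hφ hx).2]
      exact Finset.sum_congr rfl fun θ _ => congrFun hc θ
    rw [← Finset.mul_sum, hx.2, mul_one] at hsum
    exact hne (by rw [← hc, hsum, one_smul])
  obtain ⟨f, hf, hfs⟩ := Submodule.exists_le_ker_of_notMem hspan
  obtain ⟨g, hg, hgs⟩ := Submodule.exists_le_ker_of_notMem hspan'
  have hfx : f x = 0 := hfs (Submodule.subset_span (by simp))
  have hfφx : f (φ x) = 0 := hfs (Submodule.subset_span (by simp))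
  have hgx : g x = 0 := hgs (Submodule.subset_span (by simp))
  have key := h.apply_nonpos hφ hcont
    (g (φ x) • g - ((g (φ x) * g (φ b) + 1) / f (φ b)) • f) hx hb (by simp [hfx, hgx])
    (by simp [hf])
  simp only [LinearMap.sub_apply, LinearMap.smul_apply, smul_eq_mul, hfφx, mul_zero,
    sub_zero] at key
  exact hg (mul_self_eq_zero.mp (le_antisymm key (mul_self_nonneg _)))

lemma eq_of_mem_span_pair_of_notMem_span_pair {n : ℕ} {x y p q : Fin n → ℝ}
    (hx : ∑ θ, x θ = 1) (hy : ∑ θ, y θ = 1) (hp : ∑ θ, p θ = 1) (hq : ∑ θ, q θ = 1)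
    (hpxy : p ∈ Submodule.span ℝ {x, y}) (hqxy : q ∈ Submodule.span ℝ {x, y})
    (hxpq : x ∉ Submodule.span ℝ {p, q}) : p = q := by
  obtain ⟨a, b, rfl⟩ := Submodule.mem_span_pair.mp hpxy
  obtain ⟨c, d, rfl⟩ := Submodule.mem_span_pair.mp hqxy
  simp only [Pi.add_apply, Pi.smul_apply, smul_eq_mul, Finset.sum_add_distrib, ← Finset.mul_sum,
    hx, hy, mul_one] at hp hq
  obtain rfl : a = 1 - b := by linarith
  obtain rfl : c = 1 - d := by linarith
  by_cases hbd : d = b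
  · rw [hbd]
  · refine absurd (Submodule.mem_span_pair.mpr ⟨d / (d - b), -b / (d - b), ?_⟩) hxpq
    have : d - b ≠ 0 := sub_ne_zero.mpr hbd
    ext θ
    simp only [Pi.add_apply, Pi.smul_apply, smul_eq_mul]
    field_simp
    ring

lemma exists_single_notMem_span_pair {n : ℕ} (hn : 3 ≤ n) (p q : Fin n → ℝ) :
    ∃ i, (Pi.single i 1 : Fin n → ℝ) ∉ Submodule.span ℝ {p, q} := by
  by_contra! hall
  have htop : Submodule.span ℝ {p, q} = ⊤ := by
    rw [eq_top_iff, ← (Pi.basisFun ℝ (Fin n)).span_eq, Submodule.span_le]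
    rintro _ ⟨i, rfl⟩
    simpa using hall i
  have hle : Module.finrank ℝ (Submodule.span ℝ {p, q}) ≤ 2 := by
    classical
    have := finrank_span_finset_le_card (R := ℝ) ({p, q} : Finset (Fin n → ℝ))
    rw [Finset.coe_pair] at this
    exact this.trans Finset.card_le_two
  rw [htop, finrank_top, Module.finrank_fin_fun] at hle
  omega

/-- A continuous map that fixes every point of the simplex outside a proper subspace fixes the
whole simplex. -/
lemma eqOn_id_stdSimplex_of_notMem {n : ℕ} {φ : (Fin n → ℝ) → (Fin n → ℝ)}
    (hcont : ContinuousOn φ (stdSimplex ℝ (Fin n))) (S : Submodule ℝ (Fin n → ℝ))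
    {e : Fin n → ℝ} (he : e ∈ stdSimplex ℝ (Fin n)) (heS : e ∉ S)
    (hfix : ∀ x ∈ stdSimplex ℝ (Fin n), x ∉ S → φ x = x) :
    ∀ x ∈ stdSimplex ℝ (Fin n), φ x = x := by
  intro x hx
  by_cases hxS : x ∉ S
  · exact hfix x hx hxS
  rw [not_not] at hxS
  have hmem : ∀ᶠ t : ℝ in nhdsWithin 0 (Ioi 0),
      (1 - t) • x + t • e ∈ stdSimplex ℝ (Fin n) := by
    filter_upwards [Ioo_mem_nhdsGT (zero_lt_one (α := ℝ))] with t ht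
    exact convex_stdSimplex ℝ (Fin n) hx he (by linarith [ht.2]) ht.1.le (by ring)
  have hpath : Filter.Tendsto (fun t : ℝ => (1 - t) • x + t • e) (nhdsWithin 0 (Ioi 0))
      (nhds x) := by
    have : Continuous (fun t : ℝ => (1 - t) • x + t • e) := by fun_prop
    simpa using (this.tendsto 0).mono_left nhdsWithin_le_nhds
  refine tendsto_nhds_unique
    (((hcont x hx).tendsto.comp (tendsto_nhdsWithin_iff.mpr ⟨hpath, hmem⟩)).congr' ?_) hpath
  filter_upwards [hmem, self_mem_nhdsWithin] with t ht htpos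
  refine hfix _ ht fun hS => heS ?_
  rwa [Submodule.add_mem_iff_right _ (S.smul_mem _ hxS),
    Submodule.smul_mem_iff _ (ne_of_gt htpos)] at hS

/-- Bayes' law respects the Blackwell order. -/
lemma respectsBlackwell_of_eqOn_id {n : ℕ} {φ : (Fin n → ℝ) → (Fin n → ℝ)}
    (hid : ∀ x ∈ stdSimplex ℝ (Fin n), φ x = x) : RespectsBlackwell n φ := by
  intro A _ _ _ u _ a ha
  refine ⟨convex_stdSimplex ℝ (Fin n), fun x hx y hy s t hs ht hst => ?_⟩
  have hz := convex_stdSimplex ℝ (Fin n) hx hy hs ht hst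
  simp only [hid x hx, hid y hy, hid _ hz, smul_eq_mul]
  calc _ = s * ∑ θ, x θ * u (a (s • x + t • y)) θ + t * ∑ θ, y θ * u (a (s • x + t • y)) θ := by
        simp only [Finset.mul_sum, ← Finset.sum_add_distrib, Pi.add_apply, Pi.smul_apply,
          smul_eq_mul]
        exact Finset.sum_congr rfl fun θ _ => by ring
    _ ≤ _ := add_le_add (mul_le_mul_of_nonneg_left (ha x hx _) hs)
        (mul_le_mul_of_nonneg_left (ha y hy _) ht)

theorem continuous_nontrivial_blackwell_iff_bayes
    (n : ℕ) (hn : 3 ≤ n)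
    (μ : Fin n → ℝ) (hμ : μ ∈ relintSimplex n)
    (φ : (Fin n → ℝ) → (Fin n → ℝ))
    (hφ : MapsTo φ (stdSimplex ℝ (Fin n)) (stdSimplex ℝ (Fin n)))
    (hcont : ContinuousOn φ (stdSimplex ℝ (Fin n)))
    (hnontriv : ¬ ∃ c, ∀ x ∈ stdSimplex ℝ (Fin n), φ x = c) :
    RespectsBlackwell n φ ↔ ∀ x ∈ stdSimplex ℝ (Fin n), φ x = x := by
  refine ⟨fun h => ?_, respectsBlackwell_of_eqOn_id⟩
  push Not at hnontriv
  obtain ⟨b, hb, hne⟩ := hnontriv (φ μ)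
  obtain ⟨i, hi⟩ := exists_single_notMem_span_pair hn (φ b) (φ μ)
  refine eqOn_id_stdSimplex_of_notMem hcont _ (single_mem_stdSimplex ℝ i) hi fun x hx hxS => ?_
  by_contra hxne
  exact hne (eq_of_mem_span_pair_of_notMem_span_pair hx.2 (hφ hx).2 (hφ hb).2 (hφ hμ.1).2
    (h.mem_span_pair hφ hcont hx hb hxne) (h.mem_span_pair hφ hcont hx hμ.1 hxne) hxS)
end

section
/- Let n ≥ 3, let Δ be the standard simplex of probability vectors on Fin n, and fix a prior μ in the relative interior of Δ. If φ : Δ → Δ is continuous on Δ and respects the Blackwell order for μ, then either there exists x* ∈ Δ with φ(x) = x* for all x ∈ Δ, or φ(x) = x for all x ∈ Δ. -/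
open Set Finset

/-- If the interim belief at `z` strictly favours `v` over `0`, and the one at `x` does not,
then neither does `x`. -/
theorem RespectsBlackwell.dotProduct_nonpos {n : ℕ} {φ : (Fin n → ℝ) → (Fin n → ℝ)}
    (hcont : ContinuousOn φ (stdSimplex ℝ (Fin n))) (hB : RespectsBlackwell n φ)
    {x z v : Fin n → ℝ} (hx : x ∈ stdSimplex ℝ (Fin n)) (hz : z ∈ stdSimplex ℝ (Fin n))
    (hφz : 0 < φ z ⬝ᵥ v) (hφx : φ x ⬝ᵥ v ≤ 0) : x ⬝ᵥ v ≤ 0 := by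
  classical
  have hconv := hB Bool (fun b => if b then v else 0) continuous_of_discreteTopology
    (fun y => decide (0 < y ⬝ᵥ v)) (by
      intro y _ b
      change y ⬝ᵥ _ ≤ y ⬝ᵥ _
      by_cases h : 0 < y ⬝ᵥ v <;> cases b <;> simp [h] <;> linarith)
  have hW : ∀ p, 0 < φ p ⬝ᵥ v →
      ∑ θ, p θ * (if decide (0 < φ p ⬝ᵥ v) = true then v else 0) θ = p ⬝ᵥ v := by
    intro p hp
    simp only [hp, decide_true, if_true]; rfl
  have hWx : ∑ θ, x θ * (if decide (0 < φ x ⬝ᵥ v) = true then v else 0) θ = 0 := by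
    simp [not_lt.mpr hφx]
  let γ : ℝ → Fin n → ℝ := fun ε => (1 - ε) • z + ε • x
  have hγ0 : γ 0 = z := by simp [γ]
  have hγmem : MapsTo γ (Icc 0 1) (stdSimplex ℝ (Fin n)) := fun ε hε =>
    convex_stdSimplex ℝ (Fin n) hz hx (by linarith [hε.2]) hε.1 (by ring)
  have hγ : ContinuousOn (fun ε => φ (γ ε) ⬝ᵥ v) (Icc 0 1) := by
    have h1 : ContinuousOn (fun ε => φ (γ ε)) (Icc 0 1) :=
      hcont.comp (by fun_prop) hγmem
    exact (show Continuous fun p : Fin n → ℝ => p ⬝ᵥ v by fun_prop).comp_continuousOn h1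
  have hev : ∀ᶠ ε in nhdsWithin (0 : ℝ) (Ioo 0 1), 0 < φ (γ ε) ⬝ᵥ v :=
    ((hγ 0 (by simp)).mono Ioo_subset_Icc_self).eventually (lt_mem_nhds (by simpa [hγ0] using hφz))
  have : (nhdsWithin (0 : ℝ) (Ioo 0 1)).NeBot := by
    rw [nhdsWithin_Ioo_eq_nhdsGT one_pos]; infer_instance
  obtain ⟨ε, hε, hεI⟩ := (hev.and self_mem_nhdsWithin).exists
  have key := hconv.2 hz hx (sub_nonneg.2 hεI.2.le) hεI.1.le (by ring)
  change (∑ θ, (γ ε) θ * (if decide (0 < φ (γ ε) ⬝ᵥ v) = true then v else 0) θ) ≤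
    (1 - ε) • (∑ θ, z θ * (if decide (0 < φ z ⬝ᵥ v) = true then v else 0) θ) +
      ε • (∑ θ, x θ * (if decide (0 < φ x ⬝ᵥ v) = true then v else 0) θ) at key
  rw [hW _ hε, hW _ hφz, hWx] at key
  simp only [γ, add_dotProduct, smul_dotProduct, smul_eq_mul] at key
  by_contra! hpos
  nlinarith [mul_pos hεI.1 hpos]

/-- A payoff direction underestimated at `x` is maximised over the range of `φ` by `φ x`. -/
theorem RespectsBlackwell.dotProduct_le {n : ℕ} {φ : (Fin n → ℝ) → (Fin n → ℝ)}
    (hφ : MapsTo φ (stdSimplex ℝ (Fin n)) (stdSimplex ℝ (Fin n)))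
    (hcont : ContinuousOn φ (stdSimplex ℝ (Fin n))) (hB : RespectsBlackwell n φ)
    {x z v : Fin n → ℝ} (hx : x ∈ stdSimplex ℝ (Fin n)) (hz : z ∈ stdSimplex ℝ (Fin n))
    (h : φ x ⬝ᵥ v < x ⬝ᵥ v) : φ z ⬝ᵥ v ≤ φ x ⬝ᵥ v := by
  by_contra! hlt
  obtain ⟨c, hc, hc'⟩ := exists_between (lt_min hlt h)
  have hshift : ∀ p ∈ stdSimplex ℝ (Fin n), p ⬝ᵥ (v - c • 1) = p ⬝ᵥ v - c := by
    intro p hp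
    rw [dotProduct_sub, dotProduct_smul, dotProduct_one, hp.2, smul_eq_mul, mul_one]
  have := hB.dotProduct_nonpos hcont (v := v - c • 1) hx hz
    (by rw [hshift _ (hφ hz)]; linarith [min_le_left (φ z ⬝ᵥ v) (x ⬝ᵥ v)])
    (by rw [hshift _ (hφ hx)]; linarith)
  rw [hshift _ hx] at this
  linarith [min_le_right (φ z ⬝ᵥ v) (x ⬝ᵥ v)]

theorem exists_eq_smul_of_dotProduct_nonpos {n : ℕ} {d e : Fin n → ℝ} (hd : d ≠ 0)
    (h : ∀ v : Fin n → ℝ, 0 < d ⬝ᵥ v → e ⬝ᵥ v ≤ 0) : ∃ k : ℝ, e = k • d := by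
  have hdd : 0 < d ⬝ᵥ d :=
    lt_of_le_of_ne (Finset.sum_nonneg fun i _ => mul_self_nonneg _)
      (fun h0 => hd (dotProduct_self_eq_zero.1 h0.symm))
  set k := (e ⬝ᵥ d) / (d ⬝ᵥ d) with hk
  have hkd : e ⬝ᵥ d = k * (d ⬝ᵥ d) := by rw [hk]; field_simp
  refine ⟨k, ?_⟩
  set p := e - k • d with hp
  have he : e = p + k • d := by simp [hp]
  have hdp : d ⬝ᵥ p = 0 := by
    rw [hp, dotProduct_sub, dotProduct_smul, smul_eq_mul, dotProduct_comm d e]; linarith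
  have hep : e ⬝ᵥ p = p ⬝ᵥ p := by
    conv_lhs => rw [he]
    rw [add_dotProduct, smul_dotProduct, hdp]; simp
  have hle : p ⬝ᵥ p ≤ 0 := by
    have hlim : Filter.Tendsto (fun ε : ℝ => p ⬝ᵥ p + ε * (e ⬝ᵥ d))
        (nhdsWithin 0 (Ioi 0)) (nhds (p ⬝ᵥ p)) := by
      have : Continuous fun ε : ℝ => p ⬝ᵥ p + ε * (e ⬝ᵥ d) := by fun_prop
      simpa using (this.tendsto 0).mono_left nhdsWithin_le_nhds
    refine le_of_tendsto hlim ?_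
    filter_upwards [self_mem_nhdsWithin] with ε hε
    have := h (p + ε • d) (by
      rw [dotProduct_add, dotProduct_smul, hdp, zero_add]; exact mul_pos hε hdd)
    rwa [dotProduct_add, dotProduct_smul, hep] at this
  have hp0 : p = 0 := dotProduct_self_eq_zero.1
    (le_antisymm hle (Finset.sum_nonneg fun i _ => mul_self_nonneg _))
  rw [he, hp0, zero_add]

/-- If `φ` moves `x`, then its range lies on the line through `x` and `φ x`. -/
theorem RespectsBlackwell.exists_sub_eq_smul {n : ℕ} {φ : (Fin n → ℝ) → (Fin n → ℝ)}
    (hφ : MapsTo φ (stdSimplex ℝ (Fin n)) (stdSimplex ℝ (Fin n)))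
    (hcont : ContinuousOn φ (stdSimplex ℝ (Fin n))) (hB : RespectsBlackwell n φ)
    {x z : Fin n → ℝ} (hx : x ∈ stdSimplex ℝ (Fin n)) (hz : z ∈ stdSimplex ℝ (Fin n))
    (hne : φ x ≠ x) : ∃ k : ℝ, φ z - φ x = k • (x - φ x) := by
  refine exists_eq_smul_of_dotProduct_nonpos (sub_ne_zero.2 hne.symm) fun v hv => ?_
  rw [sub_dotProduct] at hv ⊢
  exact sub_nonpos.2 (hB.dotProduct_le hφ hcont hx hz (sub_pos.1 hv))

theorem exists_mem_stdSimplex_notMem_line {n : ℕ} (hn : 3 ≤ n) (y d : Fin n → ℝ) :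
    ∃ z ∈ stdSimplex ℝ (Fin n), ∀ t : ℝ, z ≠ y + t • d := by
  by_contra! h
  let i : Fin n := ⟨0, by omega⟩
  let j : Fin n := ⟨1, by omega⟩
  let k : Fin n := ⟨2, by omega⟩
  have hij : i ≠ j := by simp [i, j]
  have hik : i ≠ k := by simp [i, k]
  have hjk : j ≠ k := by simp [j, k]
  obtain ⟨r, hr⟩ := h _ (single_mem_stdSimplex ℝ i)
  obtain ⟨s, hs⟩ := h _ (single_mem_stdSimplex ℝ j)
  obtain ⟨t, ht⟩ := h _ (single_mem_stdSimplex ℝ k)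
  have hri := congrFun hr i
  have hrk := congrFun hr k
  have hsi := congrFun hs i
  have hsk := congrFun hs k
  have hti := congrFun ht i
  have htk := congrFun ht k
  simp [hij, hik, hik.symm, hjk.symm] at hri hrk hsi hsk hti htk
  have h1 : (r - s) * d i = 1 := by linarith
  have h2 : (r - s) * d k = 0 := by linarith
  have h3 : (t - r) * d k = 1 := by linarith
  rcases mul_eq_zero.1 h2 with h0 | h0 <;> simp [h0] at h1 h3


theorem continuous_blackwell_trivial_or_bayes
    (n : ℕ) (hn : 3 ≤ n)
    (μ : Fin n → ℝ) (hμ : μ ∈ relintSimplex n)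
    (φ : (Fin n → ℝ) → (Fin n → ℝ))
    (hφ : MapsTo φ (stdSimplex ℝ (Fin n)) (stdSimplex ℝ (Fin n)))
    (hcont : ContinuousOn φ (stdSimplex ℝ (Fin n)))
    (hB : RespectsBlackwell n φ) :
    (∃ xs ∈ stdSimplex ℝ (Fin n), ∀ x ∈ stdSimplex ℝ (Fin n), φ x = xs) ∨
    (∀ x ∈ stdSimplex ℝ (Fin n), φ x = x) := by
  by_cases hid : ∀ x ∈ stdSimplex ℝ (Fin n), φ x = x
  · exact Or.inr hid
  left
  push Not at hid
  obtain ⟨x, hx, hne⟩ := hid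
  refine ⟨φ x, hφ hx, fun w hw => ?_⟩
  obtain ⟨z, hz, hzline⟩ := exists_mem_stdSimplex_notMem_line hn (φ x) (x - φ x)
  obtain ⟨k, hk⟩ := hB.exists_sub_eq_smul hφ hcont hx hz hne
  have hzne : φ z ≠ z := fun h => hzline k (by rw [← hk, h]; abel)
  obtain ⟨l, hl⟩ := hB.exists_sub_eq_smul hφ hcont hx hw hne
  obtain ⟨s, hs⟩ := hB.exists_sub_eq_smul hφ hcont hz hx hzne
  obtain ⟨t, ht⟩ := hB.exists_sub_eq_smul hφ hcont hz hw hzne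
  have hts : l • (x - φ x) = (t - s) • (z - φ z) := by
    rw [← hl, sub_smul, ← ht, ← hs]; abel
  by_contra hwx
  have hts0 : t - s ≠ 0 := fun h0 => hwx <| sub_eq_zero.1 <| by rw [hl, hts, h0, zero_smul]
  refine hzline (k + (t - s)⁻¹ * l) ?_
  rw [add_smul, mul_smul, hts, inv_smul_smul₀ hts0, ← hk]
  abel
end

section
/- Let two states be given, with beliefs identified with the probability x ∈ [0,1] of state 1, and fix a prior μ ∈ (0,1). If φ : [0,1] → [0,1] is continuous and respects the Blackwell order for μ, then φ is occasionally coarse with, in addition, φ(0) = a and φ(1) = b; that is, there exist a, b with 0 ≤ a ≤ b ≤ 1 such that φ(x) = a for all x ∈ [0,a], φ(x) = x for all x ∈ [a,b], and φ(x) = b for all x ∈ [b,1]. -/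
open Set

/-- In the problem of choosing between a safe action with payoff `0` and a risky one with
payoff `s * (x - t)`, where ties are broken in favour of the safe action, the induced payoff
is convex. -/
lemma RespectsBlackwell2.convexOn_ite {φ : ℝ → ℝ} (hB : RespectsBlackwell2 φ) (s t : ℝ) :
    ConvexOn ℝ (Icc (0:ℝ) 1) (fun x => if 0 < s * (φ x - t) then s * (x - t) else 0) := by
  have h := hB Bool (fun c => cond c (s * (0 - t)) 0) (fun c => cond c (s * (1 - t)) 0)
    continuous_of_discreteTopology continuous_of_discreteTopology
    (fun y => decide (0 < s * (y - t))) (by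
      intro y _ c
      by_cases hy : 0 < s * (y - t) <;> cases c <;> simp [hy] <;> nlinarith)
  refine h.congr fun x _ => ?_
  by_cases hx : 0 < s * (φ x - t)
  · simp only [hx, decide_true, cond_true, if_true]; ring
  · simp [hx]

/-- If `φ` moves the belief `x` in the direction of the sign `s`, then `φ x` is extremal,
among all values of `φ`, in the opposite direction. -/
lemma RespectsBlackwell2.mul_le_mul_of_mul_lt {φ : ℝ → ℝ} (hB : RespectsBlackwell2 φ)
    (hcont : ContinuousOn φ (Icc (0:ℝ) 1)) {s x z : ℝ} (hs : s * s = 1)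
    (hx : x ∈ Icc (0:ℝ) 1) (hz : z ∈ Icc (0:ℝ) 1) (hsx : s * x < s * φ x) :
    s * φ x ≤ s * φ z := by
  by_contra! hlt
  obtain ⟨v, hv, hvx⟩ := exists_between (max_lt hsx hlt)
  obtain ⟨hxv, hzv⟩ := max_lt_iff.1 hv
  have hmaps : MapsTo (fun ε : ℝ => (1 - ε) * z + ε * x) (Icc 0 1) (Icc 0 1) := fun ε hε =>
    convex_Icc (0:ℝ) 1 hz hx (sub_nonneg.2 hε.2) hε.1 (sub_add_cancel 1 ε)
  have hg : ContinuousOn (fun ε : ℝ => s * φ ((1 - ε) * z + ε * x)) (Icc 0 1) :=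
    continuousOn_const.mul (hcont.comp (by fun_prop) hmaps)
  obtain ⟨ε, hε, hεv⟩ : v ∈ (fun ε : ℝ => s * φ ((1 - ε) * z + ε * x)) '' Icc 0 1 :=
    intermediate_value_Icc zero_le_one hg ⟨by simpa using hzv.le, by simpa using hvx.le⟩
  have hε0 : 0 < ε := by
    refine hε.1.lt_of_ne fun h => ?_
    subst h
    simp at hεv
    linarith
  have hst : ∀ y, s * (y - s * v) = s * y - v := fun y => by linear_combination -v * hs
  have h := (hB.convexOn_ite s (s * v)).2 hz hx (sub_nonneg.2 hε.2) hε.1 (sub_add_cancel 1 ε)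
  simp only [hst, smul_eq_mul] at h hεv
  rw [if_neg (by linarith), if_neg (by linarith), if_pos (by linarith)] at h
  nlinarith

theorem continuous_blackwell_occasionallyCoarse
    (μ : ℝ) (hμ : μ ∈ Ioo (0:ℝ) 1)
    (φ : ℝ → ℝ) (hφ : MapsTo φ (Icc (0:ℝ) 1) (Icc (0:ℝ) 1))
    (hcont : ContinuousOn φ (Icc (0:ℝ) 1))
    (hB : RespectsBlackwell2 φ) :
    ∃ a b : ℝ, 0 ≤ a ∧ a ≤ b ∧ b ≤ 1 ∧
      (∀ x ∈ Icc (0:ℝ) a, φ x = a) ∧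
      (∀ x ∈ Icc a b, φ x = x) ∧
      (∀ x ∈ Icc b (1:ℝ), φ x = b) := by
  have up : ∀ x ∈ Icc (0:ℝ) 1, ∀ z ∈ Icc (0:ℝ) 1, x < φ x → φ x ≤ φ z :=
    fun x hx z hz h => by
      simpa using hB.mul_le_mul_of_mul_lt hcont (s := 1) (by norm_num) hx hz (by simpa using h)
  have down : ∀ x ∈ Icc (0:ℝ) 1, ∀ z ∈ Icc (0:ℝ) 1, φ x < x → φ z ≤ φ x :=
    fun x hx z hz h => by
      simpa using hB.mul_le_mul_of_mul_lt hcont (s := -1) (by norm_num) hx hz (by simpa using h)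
  have hne : (Icc (0:ℝ) 1).Nonempty := nonempty_Icc.2 zero_le_one
  obtain ⟨p, hp, hmin⟩ := isCompact_Icc.exists_isMinOn hne hcont
  obtain ⟨q, hq, hmax⟩ := isCompact_Icc.exists_isMaxOn hne hcont
  rw [isMinOn_iff] at hmin
  rw [isMaxOn_iff] at hmax
  have hp' := hφ hp
  have hq' := hφ hq
  refine ⟨φ p, φ q, hp'.1, hmin q hq, hq'.2, fun x hx => ?_, fun x hx => ?_, fun x hx => ?_⟩
  · have hx1 : x ∈ Icc (0:ℝ) 1 := ⟨hx.1, hx.2.trans hp'.2⟩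
    have h := hmin x hx1
    rcases (hx.2.trans h).eq_or_lt with hxe | hlt
    · linarith [hx.2]
    · exact (up x hx1 p hp hlt).antisymm h
  · have hx1 : x ∈ Icc (0:ℝ) 1 := ⟨hp'.1.trans hx.1, hx.2.trans hq'.2⟩
    rcases lt_trichotomy (φ x) x with h | h | h
    · linarith [down x hx1 q hq h, hx.2]
    · exact h
    · linarith [up x hx1 p hp h, hx.1]
  · have hx1 : x ∈ Icc (0:ℝ) 1 := ⟨hq'.1.trans hx.1, hx.2⟩
    have h := hmax x hx1
    rcases (h.trans hx.1).eq_or_lt with hxe | hlt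
    · linarith [hx.1]
    · exact h.antisymm (down x hx1 q hq hlt)
end

section
/- Let two states be given, with beliefs identified with the probability x ∈ [0,1] of state 1, and fix a prior μ ∈ (0,1). Let φ : [0,1] → [0,1] be continuous on [0,1], continuously differentiable on (0,1), and not constant on [0,1]. Then φ respects the Blackwell order for μ if and only if φ(x) = x for all x ∈ [0,1] (Bayes' law). -/
open Set

/-- Both tie-breaking rules between a safe action and a bet on state `1` at odds `t`
yield a convex payoff when the Blackwell order is respected. -/
lemma RespectsBlackwell2.convexOn_bet {φ : ℝ → ℝ} (h : RespectsBlackwell2 φ) (t : ℝ) :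
    ConvexOn ℝ (Icc (0:ℝ) 1) (fun x => if t ≤ φ x then x - t else 0) ∧
      ConvexOn ℝ (Icc (0:ℝ) 1) (fun x => if t < φ x then x - t else 0) := by
  constructor
  · have key := h Bool (fun b => if b then -t else 0) (fun b => if b then 1 - t else 0)
      continuous_of_discreteTopology continuous_of_discreteTopology (fun y => decide (t ≤ y))
      (by
        intro y _ b
        by_cases hy : t ≤ y <;> cases b <;> simp [hy] <;> linarith)
    convert key using 2 with x
    by_cases hx : t ≤ φ x <;> simp [hx]
    ring
  · have key := h Bool (fun b => if b then -t else 0) (fun b => if b then 1 - t else 0)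
      continuous_of_discreteTopology continuous_of_discreteTopology (fun y => decide (t < y))
      (by
        intro y _ b
        by_cases hy : t < y <;> cases b <;> simp [hy] <;> linarith)
    convert key using 2 with x
    by_cases hx : t < φ x <;> simp [hx]
    ring

/-- A non-fixed interior value `t` of `φ` is attained on any interval of interior points
avoiding `t`. -/
lemma RespectsBlackwell2.eq_of_notMem_uIcc {φ : ℝ → ℝ} (h : RespectsBlackwell2 φ) {x y : ℝ}
    (hx : x ∈ Ioo (0:ℝ) 1) (hy : y ∈ Ioo (0:ℝ) 1) (hxy : φ x ∉ uIcc x y) : φ y = φ x := by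
  by_contra hne
  set t := φ x with ht
  have hsub : uIcc x y ⊆ Ioo (0:ℝ) 1 := OrdConnected.uIcc_subset inferInstance hx hy
  have hcont : ∀ {f : ℝ → ℝ}, ConvexOn ℝ (Icc (0:ℝ) 1) f → ContinuousOn f (uIcc x y) :=
    fun hf => ((hf.subset Ioo_subset_Icc_self (convex_Ioo 0 1)).continuousOn isOpen_Ioo).mono hsub
  obtain ⟨h₁, h₂⟩ := h.convexOn_bet t
  have hne' : ∀ z ∈ uIcc x y, z - t ≠ 0 := fun z hz hzt => hxy (sub_eq_zero.1 hzt ▸ hz)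
  have hg := ((hcont h₁).sub (hcont h₂)).div
    (continuousOn_id.sub (continuousOn_const (c := t))) hne'
  obtain ⟨z, hz, hzv⟩ := intermediate_value_uIcc hg (show (1/2 : ℝ) ∈ _ by
    have hx' := hne' x left_mem_uIcc
    rcases lt_or_gt_of_ne hne with hlt | hlt
    · simp [← ht, hlt.not_ge, hlt.le.not_gt, div_self hx']
      norm_num
    · simp [← ht, hlt, hlt.le, div_self hx']
      norm_num)
  have hz' := hne' z hz
  rcases lt_trichotomy (φ z) t with hlt | heq | hlt
  · simp [hlt.not_ge, hlt.le.not_gt] at hzv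
  · simp [heq, div_self hz'] at hzv
  · simp [hlt, hlt.le] at hzv

/-- A differentiable function which is locally constant away from its fixed points, in the sense
of `RespectsBlackwell2.eq_of_notMem_uIcc`, and somewhere exceeds the identity is constant. -/
lemma exists_eqOn_const_of_lt {φ : ℝ → ℝ} (hcont : ContinuousOn φ (Icc (0:ℝ) 1))
    (hdiff : DifferentiableOn ℝ φ (Ioo (0:ℝ) 1))
    (H : ∀ x ∈ Ioo (0:ℝ) 1, ∀ y ∈ Ioo (0:ℝ) 1, φ x ∉ uIcc x y → φ y = φ x)
    {x : ℝ} (hx : x ∈ Ioo (0:ℝ) 1) (hlt : x < φ x) :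
    ∃ c, ∀ y ∈ Icc (0:ℝ) 1, φ y = c := by
  refine ⟨φ x, ?_⟩
  suffices hopen : EqOn φ (fun _ => φ x) (Ioo (0:ℝ) 1) from
    hopen.of_subset_closure hcont continuousOn_const Ioo_subset_Icc_self
      (by rw [closure_Ioo zero_ne_one])
  set c := φ x with hc
  have hleft : ∀ y ∈ Ioo (0:ℝ) 1, y < c → φ y = c := fun y hy hyc =>
    H x hx y hy fun hm => (max_lt hlt hyc).not_ge hm.2
  have hright : ∀ z ∈ Ioo (0:ℝ) 1, φ z < z → ∀ y ∈ Ioo (0:ℝ) 1, φ z < y → φ y = φ z :=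
    fun z hz hzz y hy hzy => H z hz y hy fun hm => (lt_min hzz hzy).not_ge hm.1
  rcases le_or_gt 1 c with h1 | h1
  · exact fun y hy => hleft y hy (hy.2.trans_le h1)
  have hcm : c ∈ Ioo (0:ℝ) 1 := ⟨hx.1.trans hlt, h1⟩
  have hder := (hdiff.differentiableAt (isOpen_Ioo.mem_nhds hcm)).hasDerivAt
  have hcc : φ c = c := by
    have hE : EqOn φ (fun _ => c) (Ioc 0 c) := by
      refine EqOn.of_subset_closure (s := Ioo 0 c)
        (fun y hy => hleft y ⟨hy.1, hy.2.trans h1⟩ hy.2) (hcont.mono fun y hy =>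
        ⟨hy.1.le, hy.2.trans h1.le⟩) continuousOn_const Ioo_subset_Ioc_self ?_
      rw [closure_Ioo hcm.1.ne]
      exact Ioc_subset_Icc_self
    exact hE ⟨hcm.1, le_rfl⟩
  have hzero : deriv φ c = 0 := by
    refine (uniqueDiffWithinAt_Iic c).eq_deriv _ hder.hasDerivWithinAt ?_
    refine (hasDerivWithinAt_const c (Iic c) c).congr_of_eventuallyEq ?_ hcc
    filter_upwards [mem_nhdsWithin_of_mem_nhds (Ioi_mem_nhds hcm.1), self_mem_nhdsWithin]
      with y hy hyc
    rcases (show y ≤ c from hyc).eq_or_lt with rfl | hlt'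
    · exact hcc
    · exact hleft y ⟨hy, hlt'.trans h1⟩ hlt'
  rw [hzero] at hder
  have hev : ∀ᶠ z in nhds c, |φ z - c| ≤ 1 / 2 * |z - c| := by
    have := (hasDerivAt_iff_isLittleO.1 hder).def (show (0:ℝ) < 1 / 2 by norm_num)
    simpa [hcc] using this
  obtain ⟨δ, hδ, hball⟩ := Metric.eventually_nhds_iff.1 hev
  have hbelow : ∀ z, c < z → z < c + δ → φ z < z := fun z hcz hzδ => by
    have := hball (y := z) (by rw [Real.dist_eq, abs_of_pos] <;> linarith)
    rw [abs_of_pos (sub_pos.2 hcz)] at this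
    linarith [le_abs_self (φ z - c)]
  obtain ⟨w, hcw, hw⟩ := exists_between (lt_min h1 (lt_add_of_pos_right c hδ))
  have hw1 : w < 1 := hw.trans_le (min_le_left _ _)
  have hwδ : w < c + δ := hw.trans_le (min_le_right _ _)
  have hwm : w ∈ Ioo (0:ℝ) 1 := ⟨hcm.1.trans hcw, hw1⟩
  have hww := hbelow w hcw hwδ
  have hwc : φ w = c := by
    rcases lt_trichotomy (φ w) c with h | h | h
    · exact absurd ((hright w hwm hww c hcm h).symm.trans hcc) h.ne
    · exact h
    · obtain ⟨z, hcz, hzw⟩ := exists_between h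
      have hzm : z ∈ Ioo (0:ℝ) 1 := ⟨hcm.1.trans hcz, (hzw.trans hww).trans hw1⟩
      have hzz := hbelow z hcz ((hzw.trans hww).trans hwδ)
      have := hright z hzm hzz w hwm (hzz.trans (hzw.trans hww))
      linarith
  intro y hy
  rcases lt_trichotomy y c with h | h | h
  · exact hleft y hy h
  · rw [h, hcc]
  · exact (hright w hwm hww y hy (hwc ▸ h)).trans hwc

/-- The mirror image of `exists_eqOn_const_of_lt`. -/
lemma exists_eqOn_const_of_gt {φ : ℝ → ℝ} (hcont : ContinuousOn φ (Icc (0:ℝ) 1))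
    (hdiff : DifferentiableOn ℝ φ (Ioo (0:ℝ) 1))
    (H : ∀ x ∈ Ioo (0:ℝ) 1, ∀ y ∈ Ioo (0:ℝ) 1, φ x ∉ uIcc x y → φ y = φ x)
    {x : ℝ} (hx : x ∈ Ioo (0:ℝ) 1) (hlt : φ x < x) :
    ∃ c, ∀ y ∈ Icc (0:ℝ) 1, φ y = c := by
  have hIoo : ∀ y ∈ Ioo (0:ℝ) 1, 1 - y ∈ Ioo (0:ℝ) 1 := fun y hy =>
    ⟨by linarith [hy.2], by linarith [hy.1]⟩
  have hIcc : ∀ y ∈ Icc (0:ℝ) 1, 1 - y ∈ Icc (0:ℝ) 1 := fun y hy =>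
    ⟨by linarith [hy.2], by linarith [hy.1]⟩
  obtain ⟨c, hc⟩ := exists_eqOn_const_of_lt (φ := fun y => 1 - φ (1 - y)) (x := 1 - x)
    (continuousOn_const.sub (hcont.comp (by fun_prop) hIcc))
    ((differentiableOn_const 1).sub (hdiff.comp (by fun_prop) hIoo))
    (fun y hy z hz hyz => by
      rw [H (1 - y) (hIoo y hy) (1 - z) (hIoo z hz)]
      contrapose! hyz
      rw [mem_uIcc] at hyz ⊢
      rcases hyz with ⟨h₁, h₂⟩ | ⟨h₁, h₂⟩
      · exact Or.inr ⟨by linarith, by linarith⟩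
      · exact Or.inl ⟨by linarith, by linarith⟩)
    (hIoo x hx) (by simpa using hlt)
  refine ⟨1 - c, fun y hy => ?_⟩
  have := hc (1 - y) (hIcc y hy)
  rw [sub_sub_cancel] at this
  linarith

/-- Bayesian updating respects the Blackwell order. -/
lemma respectsBlackwell2_of_eqOn_id {φ : ℝ → ℝ} (h : ∀ x ∈ Icc (0:ℝ) 1, φ x = x) :
    RespectsBlackwell2 φ := by
  intro A _ _ _ u₀ u₁ _ _ a ha
  refine ⟨convex_Icc 0 1, fun x hx y hy p q hp hq hpq => ?_⟩
  have hz := convex_Icc (0:ℝ) 1 hx hy hp hq hpq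
  simp only [smul_eq_mul] at hz ⊢
  rw [h x hx, h y hy, h _ hz]
  set b := a (p * x + q * y)
  have h₁ := mul_le_mul_of_nonneg_left (ha x hx b) hp
  have h₂ := mul_le_mul_of_nonneg_left (ha y hy b) hq
  obtain rfl : q = 1 - p := by linarith
  linarith

theorem smooth_nontrivial_blackwell_iff_bayes
    (μ : ℝ) (hμ : μ ∈ Ioo (0:ℝ) 1)
    (φ : ℝ → ℝ) (hφ : MapsTo φ (Icc (0:ℝ) 1) (Icc (0:ℝ) 1))
    (hcont : ContinuousOn φ (Icc (0:ℝ) 1))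
    (hsmooth : ContDiffOn ℝ 1 φ (Ioo (0:ℝ) 1))
    (hnontriv : ¬ ∃ c, ∀ x ∈ Icc (0:ℝ) 1, φ x = c) :
    RespectsBlackwell2 φ ↔ ∀ x ∈ Icc (0:ℝ) 1, φ x = x := by
  refine ⟨fun h => ?_, respectsBlackwell2_of_eqOn_id⟩
  have hdiff := hsmooth.differentiableOn one_ne_zero
  have H : ∀ x ∈ Ioo (0:ℝ) 1, ∀ y ∈ Ioo (0:ℝ) 1, φ x ∉ uIcc x y → φ y = φ x :=
    fun x hx y hy => h.eq_of_notMem_uIcc hx hy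
  have hid : EqOn φ id (Ioo (0:ℝ) 1) := fun x hx => by
    rcases lt_trichotomy (φ x) x with hlt | heq | hlt
    · exact absurd (exists_eqOn_const_of_gt hcont hdiff H hx hlt) hnontriv
    · exact heq
    · exact absurd (exists_eqOn_const_of_lt hcont hdiff H hx hlt) hnontriv
  exact hid.of_subset_closure hcont continuousOn_id Ioo_subset_Icc_self
    (by rw [closure_Ioo zero_ne_one])
end

section
/- Let n ≥ 2, let Δ be the standard simplex of probability vectors on Fin n, and fix a prior μ in the relative interior of Δ. If a distortion function φ : Δ → Δ respects the Blackwell order for μ and φ(μ) ≠ μ, then there exists x ∈ Δ with x ≠ μ at which φ has an expansive error, i.e., φ(x) ∉ segment ℝ μ x. -/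
open Set Finset

theorem prior_error_implies_expansive_error
    (n : ℕ) (hn : 2 ≤ n)
    (μ : Fin n → ℝ) (hμ : μ ∈ relintSimplex n)
    (φ : (Fin n → ℝ) → (Fin n → ℝ))
    (hφ : MapsTo φ (stdSimplex ℝ (Fin n)) (stdSimplex ℝ (Fin n)))
    (hB : RespectsBlackwell n φ)
    (hpr : φ μ ≠ μ) :
    ∃ x ∈ stdSimplex ℝ (Fin n), x ≠ μ ∧ φ x ∉ segment ℝ μ x := by
  classical
  obtain ⟨hμs, -⟩ := hμ
  have hps := hφ hμs
  obtain ⟨i, hi⟩ : ∃ i, μ i < φ μ i := by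
    by_contra! h
    refine hpr (funext fun i => ?_)
    exact (Finset.sum_eq_sum_iff_of_le fun i _ => h i).1 (hps.2.trans hμs.2.symm) i (mem_univ i)
  by_contra! hcon
  set c : ℝ := (μ i + φ μ i) / 2 with hc
  let u : Bool → Fin n → ℝ := fun b θ => if b then (if θ = i then 1 else 0) - c else 0
  have hu_true : ∀ y ∈ stdSimplex ℝ (Fin n), ∑ θ, y θ * u true θ = y i - c := by
    intro y hy
    simp [u, mul_sub, Finset.sum_sub_distrib, ← Finset.sum_mul, hy.2]
  have hu_false : ∀ y : Fin n → ℝ, ∑ θ, y θ * u false θ = 0 := by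
    intro y
    simp [u]
  have hW := hB Bool u continuous_of_discreteTopology (fun y => decide (c < y i)) (by
    intro y hy b
    by_cases h : c < y i <;> cases b <;> simp only [h, decide_true, decide_false, hu_true y hy,
      hu_false] <;> linarith)
  have htrivial : ∀ x ∈ stdSimplex ℝ (Fin n), x i ≤ c → μ i < x i →
      ∑ θ, x θ * u (decide (c < φ x i)) θ = 0 := by
    intro x hx hxc hμx
    have hne : x ≠ μ := by
      rintro rfl
      exact lt_irrefl _ hμx
    obtain ⟨s, t, hs, ht, hst, hφx⟩ := hcon x hx hne
    have hle : φ x i ≤ c := by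
      rw [← hφx]
      simp only [Pi.add_apply, Pi.smul_apply, smul_eq_mul]
      calc s * μ i + t * x i ≤ s * c + t * c := by gcongr; exact hμx.le.trans hxc
        _ = c := by rw [← add_mul, hst, one_mul]
    rw [decide_eq_false hle.not_gt, hu_false]
  have hhalf : (0 : ℝ) ≤ 1 / 2 := by norm_num
  have hsum : (1 / 2 : ℝ) + 1 / 2 = 1 := by norm_num
  have hx := convex_stdSimplex ℝ (Fin n) hμs hps hhalf hhalf hsum
  have hm := convex_stdSimplex ℝ (Fin n) hμs hx hhalf hhalf hsum
  have hconv := hW.2 hμs hx hhalf hhalf hsum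
  have hcμ : c < φ μ i := by linarith
  simp only [smul_eq_mul] at hconv
  rw [htrivial _ hx (by simp; linarith) (by simp; linarith),
    htrivial _ hm (by simp; linarith) (by simp; linarith),
    decide_eq_true hcμ, hu_true μ hμs] at hconv
  linarith
end

section
/- Let two states be given, with beliefs identified with the probability x ∈ [0,1] of state 1, and fix a prior μ ∈ (0,1). Suppose φ : [0,1] → [0,1] respects the Blackwell order for μ, has no expansive error at any point (i.e., φ(x) ∈ [min(μ,x), max(μ,x)] for all x ∈ [0,1]), and has a contractive error at some x' ∈ (μ,1] (i.e., μ ≤ φ(x') < x'). Then there exists x* ∈ [μ, x') such that φ(x) = x* for all x ∈ [x*, 1), φ(x) = x for all x ∈ [μ, x*], and φ(1) ≥ x*. -/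
open Set

/-- Testing `φ` on the choice between a safe action with payoff `0` and a bet with payoff `x - t`:
if some `x₀ < 1` is distorted to a belief above `t`, then so is every belief above `t`. -/
lemma RespectsBlackwell2.lt_of_lt {φ : ℝ → ℝ} (hB : RespectsBlackwell2 φ) {t x₀ x : ℝ}
    (ht : 0 ≤ t) (htφ : φ t ≤ t) (htx₀ : t < x₀) (hx₀ : x₀ < 1) (h : t < φ x₀)
    (htx : t < x) (hx : x ≤ 1) : t < φ x := by
  by_contra hn
  have hW : ConvexOn ℝ (Icc (0 : ℝ) 1) (fun x => if t < φ x then x - t else 0) := by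
    have key := hB Bool (fun b => if b then -t else 0) (fun b => if b then 1 - t else 0)
      continuous_of_discreteTopology continuous_of_discreteTopology (fun y => decide (t < y))
      (by
        intro y _ b
        by_cases hy : t < y <;> cases b <;> simp [hy] <;> nlinarith)
    refine key.congr fun y _ => ?_
    by_cases hy : t < φ y <;> simp [hy]
    ring
  rcases lt_trichotomy x x₀ with hlt | heq | hgt
  · have hs := hW.slope_mono_adjacent (x := x) (y := x₀) (z := 1)
      ⟨by linarith, hx⟩ ⟨by norm_num, le_refl _⟩ hlt hx₀
    simp only [if_pos h, if_neg hn] at hs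
    rw [div_le_div_iff₀ (by linarith) (by linarith)] at hs
    split_ifs at hs <;> nlinarith [mul_pos (sub_pos.2 htx) (sub_pos.2 hx₀)]
  · exact hn (heq ▸ h)
  · have hs := hW.slope_mono_adjacent (x := t) (y := x₀) (z := x)
      ⟨ht, by linarith⟩ ⟨by linarith, hx⟩ htx₀ hgt
    simp only [if_pos h, if_neg hn, if_neg htφ.not_gt] at hs
    rw [div_le_div_iff₀ (by linarith) (by linarith)] at hs
    nlinarith [mul_pos (sub_pos.2 htx₀) (sub_pos.2 hgt)]

theorem contractive_no_expansive_two_states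
    (μ : ℝ) (hμ : μ ∈ Ioo (0:ℝ) 1)
    (φ : ℝ → ℝ) (hφ : MapsTo φ (Icc (0:ℝ) 1) (Icc (0:ℝ) 1))
    (hB : RespectsBlackwell2 φ)
    (hnoexp : ∀ x ∈ Icc (0:ℝ) 1, φ x ∈ Icc (min μ x) (max μ x))
    (x' : ℝ) (hx' : x' ∈ Ioc μ 1) (hcon : μ ≤ φ x' ∧ φ x' < x') :
    ∃ xs ∈ Ico μ x',
      (∀ x ∈ Ico xs (1:ℝ), φ x = xs) ∧
      (∀ x ∈ Icc μ xs, φ x = x) ∧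
      xs ≤ φ 1 := by
  obtain ⟨hμ0, hμ1⟩ := hμ
  have bnd : ∀ x, μ ≤ x → x ≤ 1 → μ ≤ φ x ∧ φ x ≤ x := by
    intro x h1 h2
    simpa [h1] using hnoexp x ⟨by linarith, h2⟩
  have dich : ∀ t x₀ x, μ ≤ t → t < x₀ → x₀ < 1 → t < φ x₀ → t < x → x ≤ 1 → t < φ x := by
    intro t x₀ x h1 h2 h3 h4 h5 h6
    exact hB.lt_of_lt (by linarith) (bnd t h1 (by linarith)).2 h2 h3 h4 h5 h6
  set S : Set ℝ := {t | t ∈ Ico μ 1 ∧ ∀ x ∈ Ioc t 1, t ≤ φ x} with hS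
  have hμS : μ ∈ S := ⟨⟨le_rfl, hμ1⟩, fun x hx => (bnd x hx.1.le hx.2).1⟩
  have up : ∀ t ∈ S, ∀ x, μ ≤ x → x ≤ 1 → φ x < x → t ≤ φ x := by
    rintro t ⟨⟨ht0, ht1⟩, ht⟩ x hx0 hx1 hx
    by_contra! hlt
    obtain ⟨s, hs1, hs2⟩ := exists_between (lt_min hlt hx)
    obtain ⟨hst, hsx⟩ := lt_min_iff.1 hs2
    obtain ⟨m, hm1, hm2⟩ := exists_between ht1
    have hm := ht m ⟨hm1, hm2.le⟩
    have := dich s m x ((bnd x hx0 hx1).1.trans hs1.le) (by linarith) hm2 (by linarith) hsx hx1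
    linarith
  have hbdd : BddAbove S := ⟨1, fun t ht => ht.1.2.le⟩
  have hle : ∀ x, μ ≤ x → x ≤ 1 → φ x < x → sSup S ≤ φ x := fun x h0 h1 h =>
    csSup_le ⟨μ, hμS⟩ fun t ht => up t ht x h0 h1 h
  have hμs : μ ≤ sSup S := le_csSup hbdd hμS
  have hsx' : sSup S < x' := (hle x' hx'.1.le hx'.2 hcon.2).trans_lt hcon.2
  have hfix : ∀ x ∈ Icc μ (sSup S), φ x = x := by
    intro x hx
    have hx1 : x ≤ 1 := by linarith [hx.2, hx'.2]
    refine le_antisymm (bnd x hx.1 hx1).2 ?_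
    by_contra! hlt
    linarith [hle x hx.1 hx1 hlt, hx.2]
  have hge : ∀ x, sSup S ≤ x → x ≤ 1 → sSup S ≤ φ x := by
    intro x h0 h1
    rcases (bnd x (hμs.trans h0) h1).2.lt_or_eq with h | h
    · exact hle x (hμs.trans h0) h1 h
    · rwa [h]
  refine ⟨sSup S, ⟨hμs, hsx'⟩, fun x hx => le_antisymm ?_ (hge x hx.1 hx.2.le), hfix,
    hge 1 (by linarith [hx'.2]) le_rfl⟩
  by_contra! hlt
  obtain ⟨t, ht1, ht2⟩ := exists_between hlt
  have htx : t < x := ht2.trans_le (bnd x (hμs.trans hx.1) hx.2.le).2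
  have htS : t ∈ S := ⟨⟨by linarith, htx.trans hx.2⟩, fun y hy =>
    (dich t x y (by linarith) htx hx.2 ht2 hy.1 hy.2).le⟩
  exact (le_csSup hbdd htS).not_gt ht1
end

section
/- Let n ≥ 2, let Δ be the standard simplex of probability vectors on Fin n, and fix a prior μ in the relative interior of Δ. Suppose φ : Δ → Δ respects the Blackwell order for μ, produces no expansive error at any point of Δ (φ(x) ∈ segment ℝ μ x for all x), and has a contractive error at some x₁ ∈ Δ; write x̂₁ := φ(x₁), so x̂₁ ∈ segment ℝ μ x₁ and x̂₁ ≠ x₁. Then there exists x₁* ∈ segment ℝ μ x̂₁ such that φ(x') = x₁* for every x' in the open segment between x₁* and x₁ (the segment from x₁* to x₁ excluding both endpoints). -/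
open Set Finset

/-- The three-point form of convexity, without divisions. -/
theorem ConvexOn.mul_le_of_lt_of_lt {S : Set ℝ} {g : ℝ → ℝ} (hg : ConvexOn ℝ S g) {a b c : ℝ}
    (ha : a ∈ S) (hc : c ∈ S) (hab : a < b) (hbc : b < c) :
    (c - a) * g b ≤ (c - b) * g a + (b - a) * g c := by
  have h := hg.slope_mono_adjacent ha hc hab hbc
  rw [div_le_div_iff₀ (by linarith) (by linarith)] at h
  nlinarith

section Threshold

variable {f : ℝ → ℝ} {s t : ℝ}

/-- If a threshold is exceeded at an interior point, it is exceeded at the endpoint. -/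
theorem lt_apply_one_of_lt_apply (hf : ∀ t ∈ Icc (0 : ℝ) 1, 0 ≤ f t ∧ f t ≤ t)
    (hs : 0 ≤ s) (hg : ConvexOn ℝ (Icc 0 1) (fun t => if s < f t then t - s else 0))
    (hst : s < t) (ht : t < 1) (h : s < f t) : s < f 1 := by
  by_contra h1
  have hfs : ¬ s < f s := not_lt.2 (hf s ⟨hs, by linarith⟩).2
  have key := hg.mul_le_of_lt_of_lt (a := s) (b := t) (c := 1)
    ⟨hs, by linarith⟩ ⟨by norm_num, le_rfl⟩ hst ht
  simp only [if_neg h1, if_neg hfs, if_pos h] at key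
  nlinarith [mul_pos (show 0 < 1 - s by linarith) (show 0 < t - s by linarith)]

/-- If a threshold is exceeded at one point of `(s, 1)`, it is exceeded on all of `(s, 1)`. -/
theorem lt_apply_of_lt_apply (hf : ∀ t ∈ Icc (0 : ℝ) 1, 0 ≤ f t ∧ f t ≤ t)
    (hs : 0 ≤ s) (hg : ConvexOn ℝ (Icc 0 1) (fun t => if s < f t then t - s else 0))
    {t' : ℝ} (hst : s < t) (ht : t < 1) (hst' : s < t') (ht' : t' < 1) (h : s < f t') :
    s < f t := by
  by_contra hn
  have hfs : ¬ s < f s := not_lt.2 (hf s ⟨hs, by linarith⟩).2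
  rcases lt_trichotomy t t' with hlt | rfl | hlt
  · have key := hg.mul_le_of_lt_of_lt (a := t) (b := t') (c := 1)
      ⟨by linarith, by linarith⟩ ⟨by norm_num, le_rfl⟩ hlt ht'
    simp only [if_neg hn, if_pos (lt_apply_one_of_lt_apply hf hs hg hst' ht' h), if_pos h] at key
    nlinarith [mul_pos (show 0 < 1 - t' by linarith) (show 0 < t - s by linarith)]
  · exact hn h
  · have key := hg.mul_le_of_lt_of_lt (a := s) (b := t') (c := t)
      ⟨hs, by linarith⟩ ⟨by linarith, by linarith⟩ hst' hlt
    simp only [if_neg hn, if_neg hfs, if_pos h] at key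
    nlinarith [mul_pos (show 0 < t - s by linarith) (show 0 < t' - s by linarith)]

theorem exists_eq_const_on_Ioo (hf : ∀ t ∈ Icc (0 : ℝ) 1, 0 ≤ f t ∧ f t ≤ t)
    (hg : ∀ s, ConvexOn ℝ (Icc 0 1) (fun t => if s < f t then t - s else 0)) (h1 : f 1 < 1) :
    ∃ c, 0 ≤ c ∧ c ≤ f 1 ∧ ∀ t ∈ Ioo c 1, f t = c := by
  have h0 : 0 ≤ f 1 := (hf 1 ⟨by norm_num, le_rfl⟩).1
  obtain ⟨m, hm, hm1⟩ := exists_between h1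
  have hc0 : 0 ≤ f m := (hf m ⟨by linarith, by linarith⟩).1
  have hc : f m ≤ f 1 := by
    by_contra! h
    exact lt_irrefl _ (lt_apply_one_of_lt_apply hf h0 (hg _) hm hm1 h)
  refine ⟨f m, hc0, hc, fun t ht => le_antisymm ?_ ?_⟩
  · by_contra! h
    exact lt_irrefl _ (lt_apply_of_lt_apply hf hc0 (hg _) (hc.trans_lt hm) hm1 ht.1 ht.2 h)
  · by_contra! h
    exact lt_irrefl _ (lt_apply_of_lt_apply hf (hf t ⟨hc0.trans ht.1.le, ht.2.le⟩).1 (hg _)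
      (h.trans ht.1) ht.2 (h.trans (hc.trans_lt hm)) hm1 h)

end Threshold

/-- The binary decision problem between a safe action worth `0` and an action worth `ℓ - s`. -/
theorem RespectsBlackwell.convexOn_threshold {n : ℕ} {φ : (Fin n → ℝ) → (Fin n → ℝ)}
    (hB : RespectsBlackwell n φ) (ℓ : Fin n → ℝ) (s : ℝ) :
    ConvexOn ℝ (stdSimplex ℝ (Fin n)) (fun x =>
      if s < ∑ θ, φ x θ * ℓ θ then ∑ θ, x θ * ℓ θ - s else 0) := by
  classical
  have hsum : ∀ x ∈ stdSimplex ℝ (Fin n),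
      ∑ θ, x θ * (ℓ θ - s) = ∑ θ, x θ * ℓ θ - s := fun x hx => by
    simp only [mul_sub, Finset.sum_sub_distrib, ← Finset.sum_mul, hx.2, one_mul]
  have h := hB Bool (fun b θ => if b then ℓ θ - s else 0) continuous_of_discreteTopology
    (fun y => decide (s < ∑ θ, y θ * ℓ θ)) (fun y hy b => by
      by_cases hys : s < ∑ θ, y θ * ℓ θ <;> cases b <;> simp [hys, hsum y hy] <;> linarith)
  refine h.congr fun x hx => ?_
  by_cases hxs : s < ∑ θ, φ x θ * ℓ θ <;> simp [hxs, hsum x hx]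

/-- A payoff vector whose expectation is the affine parameter along the line from `x` to `y`. -/
theorem exists_sum_lineMap_mul_eq {n : ℕ} {x y : Fin n → ℝ} (hx : x ∈ stdSimplex ℝ (Fin n))
    (hy : y ∈ stdSimplex ℝ (Fin n)) (hxy : x ≠ y) :
    ∃ ℓ : Fin n → ℝ, ∀ t : ℝ, ∑ θ, AffineMap.lineMap x y t θ * ℓ θ = t := by
  obtain ⟨i, hi⟩ := Function.ne_iff.1 hxy
  have hd : y i - x i ≠ 0 := sub_ne_zero.2 hi.symm
  refine ⟨fun θ => ((if θ = i then 1 else 0) - x i) / (y i - x i), fun t => ?_⟩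
  have h1 : ∑ θ, AffineMap.lineMap x y t θ = 1 := by
    simp [AffineMap.lineMap_apply, Finset.sum_add_distrib, ← Finset.mul_sum, hx.2, hy.2]
  simp only [mul_div_assoc', ← Finset.sum_div, mul_sub, Finset.sum_sub_distrib, ← Finset.sum_mul,
    h1, mul_ite, mul_one, mul_zero, Finset.sum_ite_eq', Finset.mem_univ, if_true]
  rw [div_eq_iff hd]
  simp [AffineMap.lineMap_apply]

theorem contractive_error_segment
    (n : ℕ) (hn : 2 ≤ n)
    (μ : Fin n → ℝ) (hμ : μ ∈ relintSimplex n)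
    (φ : (Fin n → ℝ) → (Fin n → ℝ))
    (hφ : MapsTo φ (stdSimplex ℝ (Fin n)) (stdSimplex ℝ (Fin n)))
    (hB : RespectsBlackwell n φ)
    (hnoexp : ∀ y ∈ stdSimplex ℝ (Fin n), φ y ∈ segment ℝ μ y)
    (x₁ : Fin n → ℝ) (hx₁ : x₁ ∈ stdSimplex ℝ (Fin n))
    (hcon : φ x₁ ∈ segment ℝ μ x₁ ∧ φ x₁ ≠ x₁) :
    ∃ xs ∈ segment ℝ μ (φ x₁), ∀ x' ∈ openSegment ℝ xs x₁, φ x' = xs := by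
  have hμΔ := hμ.1
  have hne : μ ≠ x₁ := by
    rintro rfl
    exact hcon.2 (by simpa using hcon.1)
  obtain ⟨ℓ, hℓ⟩ := exists_sum_lineMap_mul_eq hμΔ hx₁ hne
  have hmem : ∀ t ∈ Icc (0 : ℝ) 1, AffineMap.lineMap μ x₁ t ∈ stdSimplex ℝ (Fin n) :=
    fun t ht => (convex_stdSimplex ℝ (Fin n)).lineMap_mem hμΔ hx₁ ht
  set f : ℝ → ℝ := fun t => ∑ θ, φ (AffineMap.lineMap μ x₁ t) θ * ℓ θ with hfdef
  have hφf : ∀ t ∈ Icc (0 : ℝ) 1, (0 ≤ f t ∧ f t ≤ t) ∧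
      φ (AffineMap.lineMap μ x₁ t) = AffineMap.lineMap μ x₁ (f t) := fun t ht => by
    have h := hnoexp _ (hmem t ht)
    rw [segment_eq_image_lineMap] at h
    obtain ⟨r, hr, hrt⟩ := h
    have hrt' : φ (AffineMap.lineMap μ x₁ t) = AffineMap.lineMap μ x₁ (r * t) := by
      rw [← hrt]
      simp [AffineMap.lineMap_apply, mul_smul]
    have hft : f t = r * t := by
      simp only [hfdef, hrt', hℓ]
    rw [hft]
    exact ⟨⟨mul_nonneg hr.1 ht.1, mul_le_of_le_one_left ht.1 hr.2⟩, hrt'⟩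
  have hone : (1 : ℝ) ∈ Icc (0 : ℝ) 1 := ⟨zero_le_one, le_rfl⟩
  have hφ1 : φ x₁ = AffineMap.lineMap μ x₁ (f 1) := by simpa using (hφf 1 hone).2
  have hf1 : f 1 < 1 := (hφf 1 hone).1.2.lt_of_ne fun h => hcon.2 (by rw [hφ1, h]; simp)
  have hg : ∀ s, ConvexOn ℝ (Icc 0 1) (fun t => if s < f t then t - s else 0) := fun s => by
    have h := ((hB.convexOn_threshold ℓ s).comp_affineMap (AffineMap.lineMap μ x₁)).subset
      hmem (convex_Icc 0 1)
    simpa only [Function.comp_def, hℓ] using h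
  obtain ⟨c, hc0, hc1, hc⟩ := exists_eq_const_on_Ioo (fun t ht => (hφf t ht).1) hg hf1
  refine ⟨AffineMap.lineMap μ x₁ c, ?_, fun x' hx' => ?_⟩
  · have hseg : AffineMap.lineMap μ x₁ c ∈ AffineMap.lineMap μ x₁ '' segment ℝ 0 (f 1) :=
      mem_image_of_mem _ (by rw [segment_eq_Icc (hc0.trans hc1)]; exact ⟨hc0, hc1⟩)
    rw [image_segment] at hseg
    simpa [hφ1] using hseg
  · have himg : x' ∈ AffineMap.lineMap μ x₁ '' openSegment ℝ c 1 := by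
      rw [image_openSegment]
      simpa using hx'
    obtain ⟨t, ht, rfl⟩ := himg
    rw [openSegment_eq_Ioo (hc1.trans_lt hf1)] at ht
    rw [(hφf t ⟨hc0.trans ht.1.le, ht.2.le⟩).2, hc t ht]
end

section
/- Let n ≥ 2, let Δ be the standard simplex of probability vectors on Fin n, and fix a prior μ in the relative interior of Δ. Suppose φ : Δ → Δ respects the Blackwell order for μ and there exists x* ∈ Δ such that φ(x) = x* for all x in the relative interior of Δ. If e is a vertex of Δ (a standard basis vector) with φ(e) ≠ e, then φ(e) ∈ segment ℝ x* e (the line segment between x* and e). -/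
open Set Finset

/-- On the simplex, an affine functional is the expected utility of a single action. -/
lemma sum_mul_apply_single_sub {n : ℕ} (f : (Fin n → ℝ) →L[ℝ] ℝ) (c : ℝ) {y : Fin n → ℝ}
    (hy : y ∈ stdSimplex ℝ (Fin n)) :
    ∑ θ, y θ * (f (Pi.single θ 1) - c) = f y - c := by
  simp only [mul_sub, Finset.sum_sub_distrib, ← Finset.sum_mul, hy.2, one_mul]
  conv_rhs => rw [pi_eq_sum_univ' y]
  simp

theorem vertex_error_constraint
    (n : ℕ) (hn : 2 ≤ n)
    (μ : Fin n → ℝ) (hμ : μ ∈ relintSimplex n)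
    (φ : (Fin n → ℝ) → (Fin n → ℝ))
    (hφ : MapsTo φ (stdSimplex ℝ (Fin n)) (stdSimplex ℝ (Fin n)))
    (hB : RespectsBlackwell n φ)
    (xs : Fin n → ℝ) (hxs : xs ∈ stdSimplex ℝ (Fin n))
    (htriv : ∀ x ∈ relintSimplex n, φ x = xs)
    (i : Fin n) (hvert : φ (Pi.single i 1) ≠ Pi.single i 1) :
    φ (Pi.single i 1) ∈ segment ℝ xs (Pi.single i 1) := by
  by_contra hp
  set e : Fin n → ℝ := Pi.single i 1
  have heS : e ∈ stdSimplex ℝ (Fin n) := single_mem_stdSimplex ℝ i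
  have hclosed : IsClosed (segment ℝ xs e) := by
    rw [← convexHull_pair (𝕜 := ℝ)]
    exact (Set.toFinite {xs, e}).isClosed_convexHull ℝ
  obtain ⟨f, c, hf, hfp⟩ := geometric_hahn_banach_closed_point (convex_segment xs e) hclosed hp
  have hfxs : f xs < c := hf _ (left_mem_segment ℝ xs e)
  have hfe : f e < c := hf _ (right_mem_segment ℝ xs e)
  -- A binary problem: a safe action worth zero, and a bet worth `f y - c` at belief `y`.
  let u : Bool → Fin n → ℝ := fun b θ => if b then f (Pi.single θ 1) - c else 0
  let a : (Fin n → ℝ) → Bool := fun y => decide (c < f y)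
  have hconv := hB Bool u continuous_of_discreteTopology a (by
    intro y hy b
    have hval := sum_mul_apply_single_sub f c hy
    by_cases h : c < f y <;> cases b <;> simp [u, a, h, hval] <;> linarith)
  have hint : ∀ x ∈ relintSimplex n, ∑ θ, x θ * u (a (φ x)) θ = 0 := by
    intro x hx
    simp [htriv x hx, u, a, hfxs.le]
  have hmid : (1 / 2 : ℝ) • e + (1 / 2 : ℝ) • μ ∈ relintSimplex n := by
    refine ⟨convex_stdSimplex ℝ (Fin n) heS hμ.1 (by norm_num) (by norm_num) (by norm_num), ?_⟩
    intro θ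
    have h₁ := heS.1 θ
    have h₂ := hμ.2 θ
    simp only [Pi.add_apply, Pi.smul_apply, smul_eq_mul]
    linarith
  have hWe : ∑ θ, e θ * u (a (φ e)) θ = f e - c := by
    simpa [u, a, hfp] using sum_mul_apply_single_sub f c heS
  have hineq := hconv.2 heS hμ.1 (by norm_num : (0 : ℝ) ≤ 1 / 2)
    (by norm_num : (0 : ℝ) ≤ 1 / 2) (by norm_num)
  simp only [hint _ hmid, hint _ hμ, hWe, smul_eq_mul] at hineq
  linarith
end

section
/- Let n ≥ 2, let Δ be the standard simplex of probability vectors on Fin n, and fix a prior μ in the relative interior of Δ. Suppose φ : Δ → Δ respects the Blackwell order for μ. Let x, y ∈ Δ be distinct points with μ in the open segment between x and y, at each of which φ has an expansive error (φ(x) ∉ segment ℝ μ x and φ(y) ∉ segment ℝ μ y). Suppose there are λ* ∈ (0,1) and points x̂, ŷ ∈ Δ such that φ(λx + (1−λ)y) = ŷ for all λ ∈ [0, λ*) and φ(λx + (1−λ)y) = x̂ for all λ ∈ (λ*, 1]. Then x̂ = ŷ and φ(λx + (1−λ)y) = x̂ for all λ ∈ [0,1]. -/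
open Set Finset

/-- Two distinct beliefs `z`, `w` are told apart by a two-action problem with an optimal selection
under which the expected payoffs of the two actions differ at a given belief `p`. -/
lemma exists_decision_separating {n : ℕ} {p z w : Fin n → ℝ} (hp : p ∈ stdSimplex ℝ (Fin n))
    (hz : z ∈ stdSimplex ℝ (Fin n)) (hw : w ∈ stdSimplex ℝ (Fin n)) (hzw : z ≠ w) :
    ∃ (u : Bool → Fin n → ℝ) (a : (Fin n → ℝ) → Bool),
      (∀ q : Fin n → ℝ, ∀ b : Bool, ∑ θ, q θ * u b θ ≤ ∑ θ, q θ * u (a q) θ) ∧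
      ∑ θ, p θ * u (a z) θ ≠ ∑ θ, p θ * u (a w) θ := by
  have hpos : 0 < ∑ θ, (z θ - w θ) ^ 2 := by
    obtain ⟨θ, hθ⟩ := Function.ne_iff.mp hzw
    exact Finset.sum_pos' (fun i _ => sq_nonneg _)
      ⟨θ, Finset.mem_univ _, by have := sub_ne_zero.mpr hθ; positivity⟩
  have hlt : ∑ θ, w θ * (z θ - w θ) < ∑ θ, z θ * (z θ - w θ) := by
    rw [← sub_pos, ← Finset.sum_sub_distrib]
    convert hpos using 2
    ring
  obtain ⟨c, hc, hc', hcp⟩ : ∃ c, ∑ θ, w θ * (z θ - w θ) < c ∧ c ≤ ∑ θ, z θ * (z θ - w θ) ∧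
      c ≠ ∑ θ, p θ * (z θ - w θ) := by
    by_cases h : ∑ θ, z θ * (z θ - w θ) = ∑ θ, p θ * (z θ - w θ)
    · exact ⟨(∑ θ, w θ * (z θ - w θ) + ∑ θ, z θ * (z θ - w θ)) / 2, by linarith, by linarith,
        by intro h'; linarith⟩
    · exact ⟨_, hlt, le_rfl, h⟩
  have hsum {q : Fin n → ℝ} (hq : q ∈ stdSimplex ℝ (Fin n)) :
      ∑ θ, q θ * (z θ - w θ - c) = ∑ θ, q θ * (z θ - w θ) - c := by
    simp only [mul_sub _ _ c, Finset.sum_sub_distrib, ← Finset.sum_mul, hq.2, one_mul]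
  let a : (Fin n → ℝ) → Bool := fun q => decide (0 ≤ ∑ θ, q θ * (z θ - w θ - c))
  have haz : a z = true := decide_eq_true (by rw [hsum hz]; linarith)
  have haw : a w = false := decide_eq_false (by rw [hsum hw]; linarith)
  refine ⟨fun b θ => if b then z θ - w θ - c else 0, a, fun q b => ?_, ?_⟩
  · by_cases h : 0 ≤ ∑ θ, q θ * (z θ - w θ - c)
    · have ha : a q = true := decide_eq_true h
      cases b <;> simp [ha, h]
    · have ha : a q = false := decide_eq_false h
      cases b <;> simp [ha, (not_le.mp h).le]
  · simp only [haz, haw, if_true, Bool.false_eq_true, if_false, mul_zero, Finset.sum_const_zero,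
      hsum hp]
    exact sub_ne_zero.mpr hcp.symm

/-- A distortion respecting the Blackwell order that is constant on the part of a segment strictly
beyond an interior point takes the same value at that point. -/
lemma RespectsBlackwell.eq_of_eqOn_Ioc {n : ℕ} {φ : (Fin n → ℝ) → (Fin n → ℝ)}
    (hB : RespectsBlackwell n φ) (hφ : MapsTo φ (stdSimplex ℝ (Fin n)) (stdSimplex ℝ (Fin n)))
    {x y z : Fin n → ℝ} (hx : x ∈ stdSimplex ℝ (Fin n)) (hy : y ∈ stdSimplex ℝ (Fin n))
    (hz : z ∈ stdSimplex ℝ (Fin n)) {l₀ : ℝ} (hl₀ : l₀ ∈ Ioo (0 : ℝ) 1)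
    (h : ∀ l ∈ Ioc l₀ (1 : ℝ), φ (l • x + (1 - l) • y) = z) :
    φ (l₀ • x + (1 - l₀) • y) = z := by
  by_contra hne
  have hmem : ∀ l ∈ Icc (0 : ℝ) 1, l • x + (1 - l) • y ∈ stdSimplex ℝ (Fin n) := fun l hl =>
    convex_stdSimplex ℝ (Fin n) hx hy hl.1 (sub_nonneg.mpr hl.2) (by ring)
  have hp := hmem l₀ (Ioo_subset_Icc_self hl₀)
  obtain ⟨u, a, hopt, hval⟩ := exists_decision_separating hp (hφ hp) hz hne
  have hconv := hB Bool u continuous_of_discreteTopology a fun q _ => hopt q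
  have hline (l : ℝ) : AffineMap.lineMap y x l = l • x + (1 - l) • y := by
    rw [AffineMap.lineMap_apply_module, add_comm]
  have hcont : ContinuousAt ((fun q => ∑ θ, q θ * u (a (φ q)) θ) ∘
      (AffineMap.lineMap y x : ℝ →ᵃ[ℝ] Fin n → ℝ)) l₀ := by
    refine (((hconv.comp_affineMap (AffineMap.lineMap y x)).subset (fun l hl => ?_)
      (convex_Ioo 0 1)).continuousOn isOpen_Ioo).continuousAt (isOpen_Ioo.mem_nhds hl₀)
    rw [Set.mem_preimage, hline]
    exact hmem l (Ioo_subset_Icc_self hl)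
  have hlin : Continuous fun l : ℝ => ∑ θ, (l • x + (1 - l) • y) θ * u (a z) θ := by
    simp only [Pi.add_apply, Pi.smul_apply, smul_eq_mul]
    fun_prop
  have hlim := (hlin.continuousAt (x := l₀)).tendsto.mono_left (nhdsWithin_le_nhds (s := Ioi l₀))
  have hlim' := (hcont.tendsto.mono_left (nhdsWithin_le_nhds (s := Ioi l₀))).congr'
    (f₂ := fun l : ℝ => ∑ θ, (l • x + (1 - l) • y) θ * u (a z) θ) (by
      filter_upwards [Ioc_mem_nhdsGT hl₀.2] with l hl
      simp only [Function.comp_apply, hline, h l hl])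
  refine hval ?_
  have := tendsto_nhds_unique hlim' hlim
  simpa only [Function.comp_apply, hline] using this

theorem filling_the_gap
    (n : ℕ) (hn : 2 ≤ n)
    (μ : Fin n → ℝ) (hμ : μ ∈ relintSimplex n)
    (φ : (Fin n → ℝ) → (Fin n → ℝ))
    (hφ : MapsTo φ (stdSimplex ℝ (Fin n)) (stdSimplex ℝ (Fin n)))
    (hB : RespectsBlackwell n φ)
    (x y : Fin n → ℝ) (hx : x ∈ stdSimplex ℝ (Fin n)) (hy : y ∈ stdSimplex ℝ (Fin n))
    (hxy : x ≠ y) (hμseg : μ ∈ openSegment ℝ x y)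
    (hex : φ x ∉ segment ℝ μ x) (hey : φ y ∉ segment ℝ μ y)
    (l₀ : ℝ) (hl₀ : l₀ ∈ Ioo (0:ℝ) 1)
    (xh yh : Fin n → ℝ) (hxh : xh ∈ stdSimplex ℝ (Fin n)) (hyh : yh ∈ stdSimplex ℝ (Fin n))
    (hlow : ∀ l ∈ Ico (0:ℝ) l₀, φ (l • x + (1 - l) • y) = yh)
    (hhigh : ∀ l ∈ Ioc l₀ (1:ℝ), φ (l • x + (1 - l) • y) = xh) :
    xh = yh ∧ ∀ l ∈ Icc (0:ℝ) 1, φ (l • x + (1 - l) • y) = xh := by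
  have hmid_high := hB.eq_of_eqOn_Ioc hφ hx hy hxh hl₀ hhigh
  have hmid_low : φ (l₀ • x + (1 - l₀) • y) = yh := by
    have := hB.eq_of_eqOn_Ioc hφ (l₀ := 1 - l₀) hy hx hyh
      ⟨by linarith [hl₀.2], by linarith [hl₀.1]⟩ fun l hl => by
        rw [← hlow (1 - l) ⟨by linarith [hl.2], by linarith [hl.1]⟩, sub_sub_cancel, add_comm]
    rwa [sub_sub_cancel, add_comm] at this
  have heq : xh = yh := hmid_high.symm.trans hmid_low
  refine ⟨heq, fun l hl => ?_⟩
  rcases lt_trichotomy l l₀ with hlt | rfl | hgt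
  · exact (hlow l ⟨hl.1, hlt⟩).trans heq.symm
  · exact hmid_high
  · exact hhigh l ⟨hgt, hl.2⟩
end

section
/- Let n ≥ 2, let Δ be the standard simplex of probability vectors on Fin n with the Euclidean metric, and fix a prior μ in the relative interior of Δ. Suppose φ : Δ → Δ respects the Blackwell order for μ. If x is in the relative interior of Δ and φ(x) ≠ x, then there exists ε > 0 such that φ(x') = φ(x) for every x' ∈ Δ with ‖x' − x‖ < ε. -/
open Set Finset

/-- A segment in the simplex ending at a full-support belief can be extended beyond it. -/
lemma exists_extend_mem_stdSimplex {n : ℕ} {a b : Fin n → ℝ} (ha : a ∈ stdSimplex ℝ (Fin n))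
    (hb : b ∈ relintSimplex n) :
    ∃ δ > (0 : ℝ), b + δ • (b - a) ∈ stdSimplex ℝ (Fin n) := by
  have hδ : ∃ δ > (0 : ℝ), ∀ θ, δ ≤ b θ := by
    rcases isEmpty_or_nonempty (Fin n) with h | h
    · exact ⟨1, one_pos, fun θ => (h.false θ).elim⟩
    · obtain ⟨θ₀, hθ₀⟩ := Finite.exists_min b
      exact ⟨b θ₀, hb.2 θ₀, hθ₀⟩
  obtain ⟨δ, hδ, hle⟩ := hδ
  refine ⟨δ, hδ, fun θ => ?_, ?_⟩
  · have h1 : a θ ≤ 1 := (mem_Icc_of_mem_stdSimplex ha θ).2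
    have h2 : 0 ≤ δ * (1 - a θ) := mul_nonneg hδ.le (sub_nonneg.2 h1)
    have h3 : 0 ≤ δ * b θ := mul_nonneg hδ.le (hb.2 θ).le
    simp only [Pi.add_apply, Pi.smul_apply, Pi.sub_apply, smul_eq_mul]
    linarith [hle θ]
  · simp [sum_add_distrib, ← mul_sum, ha.2, hb.1.2]

/-- Consider the choice between a payoff vector `v` and the zero payoff, where `v` is taken exactly
at perceived beliefs in `S`. If `v` is profitable at both `a` and `b`, it cannot be rejected at `a`
and taken at `b`. -/
lemma RespectsBlackwell.mem_of_mem {n : ℕ} {φ : (Fin n → ℝ) → (Fin n → ℝ)}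
    (hB : RespectsBlackwell n φ) (v : Fin n → ℝ) {S : Set (Fin n → ℝ)}
    (hpos : ∀ z, 0 < z ⬝ᵥ v → z ∈ S) (hnonneg : ∀ z ∈ S, 0 ≤ z ⬝ᵥ v)
    {a b : Fin n → ℝ} (ha : a ∈ stdSimplex ℝ (Fin n)) (hb : b ∈ relintSimplex n)
    (hav : 0 < a ⬝ᵥ v) (hbv : 0 < b ⬝ᵥ v) (hbS : φ b ∈ S) : φ a ∈ S := by
  classical
  by_contra haS
  obtain ⟨δ, hδ, hc⟩ := exists_extend_mem_stdSimplex ha hb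
  set c := b + δ • (b - a) with hcdef
  have hW := hB Bool (fun i => if i then v else 0) continuous_of_discreteTopology
    (fun z => decide (z ∈ S)) (by
      intro z _ i
      change z ⬝ᵥ (if i then v else 0) ≤ z ⬝ᵥ (if decide (z ∈ S) then v else 0)
      by_cases hz : z ∈ S
      · cases i <;> simp [hz, hnonneg z hz]
      · have := not_lt.1 (mt (hpos z) hz)
        cases i <;> simp [hz, this])
  change ConvexOn ℝ _ (fun z => z ⬝ᵥ (if decide (φ z ∈ S) then v else 0)) at hW
  have hδ_one : 0 < 1 + δ := by positivity
  have hcomb : (1 / (1 + δ)) • c + (δ / (1 + δ)) • a = b := by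
    ext θ
    simp only [hcdef, Pi.add_apply, Pi.smul_apply, Pi.sub_apply, smul_eq_mul]
    field_simp
    ring
  have hconv := hW.2 hc ha (show 0 ≤ 1 / (1 + δ) by positivity)
    (show 0 ≤ δ / (1 + δ) by positivity) (by field_simp)
  rw [hcomb] at hconv
  have hcv : c ⬝ᵥ v = b ⬝ᵥ v + δ * (b ⬝ᵥ v - a ⬝ᵥ v) := by
    simp [hcdef, add_dotProduct, sub_dotProduct]
  simp only [hbS, haS, decide_true, decide_false, if_true, smul_eq_mul, dotProduct_zero,
    mul_zero, add_zero, Bool.false_eq_true, if_false] at hconv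
  rw [one_div_mul_eq_div, le_div_iff₀ hδ_one] at hconv
  have hδa : 0 < δ * a ⬝ᵥ v := mul_pos hδ hav
  have hδb : 0 < δ * b ⬝ᵥ v := mul_pos hδ hbv
  by_cases hcS : φ c ∈ S
  · simp only [hcS, decide_true, if_true, hcv] at hconv
    linarith
  · simp only [hcS, decide_false, Bool.false_eq_true, if_false, dotProduct_zero] at hconv
    linarith

/-- Two distinct beliefs `x` and `p` are separated by a hyperplane through `p`. -/
lemma exists_dotProduct_eq_zero_and_pos {n : ℕ} {x p : Fin n → ℝ}
    (hx : x ∈ stdSimplex ℝ (Fin n)) (hp : p ∈ stdSimplex ℝ (Fin n)) (hne : p ≠ x) :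
    ∃ v : Fin n → ℝ, p ⬝ᵥ v = 0 ∧ 0 < x ⬝ᵥ v := by
  have key : ∀ z ∈ stdSimplex ℝ (Fin n),
      z ⬝ᵥ (x - p - fun _ => p ⬝ᵥ (x - p)) = z ⬝ᵥ (x - p) - p ⬝ᵥ (x - p) := by
    intro z hz
    rw [dotProduct_sub]
    congr 1
    simp only [dotProduct]
    rw [← sum_mul, hz.2, one_mul]
  refine ⟨_, (key p hp).trans (sub_self _), ?_⟩
  rw [key x hx, ← sub_dotProduct]
  have h0 : (0 : ℝ) ≤ (x - p) ⬝ᵥ (x - p) := sum_nonneg fun i _ => mul_self_nonneg _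
  exact h0.lt_of_ne' fun h => hne (sub_eq_zero.1 (dotProduct_self_eq_zero.1 h)).symm

theorem locally_constant_at_error
    (n : ℕ) (hn : 2 ≤ n)
    (μ : Fin n → ℝ) (hμ : μ ∈ relintSimplex n)
    (φ : (Fin n → ℝ) → (Fin n → ℝ))
    (hφ : MapsTo φ (stdSimplex ℝ (Fin n)) (stdSimplex ℝ (Fin n)))
    (hB : RespectsBlackwell n φ)
    (x : Fin n → ℝ) (hx : x ∈ relintSimplex n) (herr : φ x ≠ x) :
    ∃ ε > 0, ∀ x' ∈ stdSimplex ℝ (Fin n), ‖x' - x‖ < ε → φ x' = φ x := by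
  obtain ⟨v, hpv, hxv⟩ := exists_dotProduct_eq_zero_and_pos hx.1 (hφ hx.1) herr
  have hcont : Continuous fun z : Fin n → ℝ => z ⬝ᵥ v := by
    unfold dotProduct
    fun_prop
  have hev : ∀ᶠ z in nhds x, 0 < z ⬝ᵥ v ∧ ∀ θ, 0 < z θ :=
    (hcont.continuousAt.eventually_const_lt hxv).and <| Filter.eventually_all.2 fun θ =>
      (continuous_apply θ).continuousAt.eventually_const_lt (hx.2 θ)
  obtain ⟨ε, hε, hball⟩ := Metric.eventually_nhds_iff.1 hev
  refine ⟨ε, hε, fun y hy hdist => ?_⟩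
  obtain ⟨hyv, hypos⟩ := hball (by rwa [dist_eq_norm])
  have hnot : ¬ 0 < φ y ⬝ᵥ v := fun h => by
    have : φ x ∈ {z : Fin n → ℝ | 0 < z ⬝ᵥ v} :=
      hB.mem_of_mem v (fun _ => id) (fun _ (h : 0 < _) => h.le) hx.1 ⟨hy, hypos⟩ hxv hyv h
    exact absurd hpv this.ne'
  have hmem : φ y ∈ {z : Fin n → ℝ | 0 < z ⬝ᵥ v ∨ z = φ x} := by
    refine hB.mem_of_mem v (fun _ => Or.inl) ?_ hy hx hyv hxv (Or.inr rfl)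
    rintro z (hz | rfl)
    exacts [hz.le, hpv.ge]
  exact hmem.resolve_left hnot
end
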